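/- arXiv:1412.5082 — 9 statements merged into one kernel-verified Lean document; each statement's English description precedes it below -/
import Mathlib

section
/- Let c ≥ 1 be a real number. Then there exist a positive integer n and a real constant c' (depending only on c) such that for every finite nonempty set A of integers with |A+A| ≤ c·|A|, there exist integers a, q₁, …, qₙ and positive integers l₁, …, lₙ such that A is contained in the n-dimensional arithmetic progression Q = {a + x₁q₁ + ⋯ + xₙqₙ : 0 ≤ xᵢ < lᵢ for i = 1, …, n} and |Q| ≤ c'·|A|. -/
open Pointwise

/-- The generalized arithmetic progression based at `0` with the given list of (length, step)
pairs: the set of all `∑ jᵢ • vᵢ` with `0 ≤ jᵢ ≤ lᵢ`. -/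
def progression {G : Type*} [AddCommGroup G] : List (ℕ × G) → Set G
  | [] => {0}
  | (l, v) :: L => {x | ∃ j ≤ l, ∃ y ∈ progression L, x = y + j • v}

namespace progression

variable {G H : Type*} [AddCommGroup G] [AddCommGroup H]

lemma zero_mem (L : List (ℕ × G)) : (0 : G) ∈ progression L := by
  induction L with
  | nil => rfl
  | cons p L ih => exact ⟨0, Nat.zero_le _, 0, ih, by simp⟩

lemma subset_cons (p : ℕ × G) (L : List (ℕ × G)) : progression L ⊆ progression (p :: L) :=
  fun x hx => ⟨0, Nat.zero_le _, x, hx, by simp⟩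

lemma nsmul_mem_cons {l j : ℕ} (hj : j ≤ l) (v : G) (L : List (ℕ × G)) :
    j • v ∈ progression ((l, v) :: L) :=
  ⟨j, hj, 0, zero_mem L, by simp⟩

lemma finite (L : List (ℕ × G)) : (progression L).Finite := by
  induction L with
  | nil => exact Set.finite_singleton 0
  | cons p L ih =>
    refine ((Set.finite_Iic p.1).image2 (fun j y => y + j • p.2) ih).subset ?_
    rintro x ⟨j, hj, y, hy, rfl⟩
    exact ⟨j, hj, y, hy, rfl⟩

/-- A map which is additive on a set containing a progression sends it to a progression. -/
lemma image_eq {X : Set G} {φ : G → H}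
    (hφ : ∀ x ∈ X, ∀ y ∈ X, x + y ∈ X → φ (x + y) = φ x + φ y) (L : List (ℕ × G))
    (hL : progression L ⊆ X) :
    φ '' progression L = progression (L.map (Prod.map id φ)) := by
  have h0X := hL (zero_mem L)
  have h0 : φ 0 = 0 := by simpa using hφ 0 h0X 0 h0X (by simpa using h0X)
  induction L with
  | nil => simp [progression, h0]
  | cons p L ih =>
    obtain ⟨l, v⟩ := p
    have ih := ih ((subset_cons _ L).trans hL)
    have hmul : ∀ j ≤ l, φ (j • v) = j • φ v := by
      intro j
      induction j with
      | zero => simp [h0]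
      | succ j ihj =>
        intro hj
        have h1 : v ∈ X := by simpa using hL (nsmul_mem_cons (show 1 ≤ l by omega) v L)
        rw [succ_nsmul, hφ _ (hL (nsmul_mem_cons (by omega) v L)) _ h1, ihj (by omega), succ_nsmul]
        rw [← succ_nsmul]
        exact hL (nsmul_mem_cons hj v L)
    have hadd : ∀ j ≤ l, ∀ y ∈ progression L, φ (y + j • v) = φ y + j • φ v := by
      intro j hj y hy
      rw [← hmul j hj]
      exact hφ _ (hL (subset_cons _ L hy)) _ (hL (nsmul_mem_cons hj v L)) (hL ⟨j, hj, y, hy, rfl⟩)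
    ext z
    simp only [List.map_cons, Prod.map_apply, id_eq, progression, ← ih, Set.mem_image,
      Set.mem_ofPred_eq]
    constructor
    · rintro ⟨_, ⟨j, hj, y, hy, rfl⟩, rfl⟩
      exact ⟨j, hj, _, ⟨y, hy, rfl⟩, hadd j hj y hy⟩
    · rintro ⟨j, hj, _, ⟨y, hy, rfl⟩, rfl⟩
      exact ⟨_, ⟨j, hj, y, hy, rfl⟩, hadd j hj y hy⟩

lemma image_hom (φ : G →+ H) (L : List (ℕ × G)) :
    φ '' progression L = progression (L.map (Prod.map id φ)) :=
  image_eq (X := Set.univ) (fun x _ y _ _ => map_add φ x y) L (Set.subset_univ _)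

lemma append (L M : List (ℕ × G)) :
    progression (L ++ M) = progression L + progression M := by
  induction L with
  | nil => simp [progression]
  | cons p L ih =>
    ext z
    simp only [List.cons_append, progression, ih, Set.mem_ofPred_eq, Set.mem_add]
    constructor
    · rintro ⟨j, hj, _, ⟨x, hx, y, hy, rfl⟩, rfl⟩
      exact ⟨x + j • p.2, ⟨j, hj, x, hx, rfl⟩, y, hy, by abel⟩
    · rintro ⟨_, ⟨j, hj, x, hx, rfl⟩, y, hy, rfl⟩
      exact ⟨j, hj, x + y, ⟨x, hx, y, hy, rfl⟩, by abel⟩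

lemma neg_eq (L : List (ℕ × G)) :
    -progression L = progression (L.map (Prod.map id Neg.neg)) := by
  rw [← Set.image_neg_eq_neg]
  exact image_hom (negAddMonoidHom : G →+ G) L

/-- The cube spanned by a list of vectors contains each of them. -/
lemma mem_cube {F : List G} {x : G} (hx : x ∈ F) :
    x ∈ progression (F.map fun v => (1, v)) := by
  induction F with
  | nil => simp at hx
  | cons v F ih =>
    rcases List.mem_cons.1 hx with rfl | hx
    · simpa using nsmul_mem_cons (le_refl 1) x (F.map fun v => (1, v))
    · exact subset_cons _ _ (ih hx)

lemma ncard_cube_le (F : List G) :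
    (progression (F.map fun v => (1, v))).ncard ≤ 2 ^ F.length := by
  induction F with
  | nil => simp [progression]
  | cons v F ih =>
    set P := progression (F.map fun v => (1, v))
    have hP : P.Finite := finite _
    have hsub : progression ((v :: F).map fun v => (1, v)) ⊆ P ∪ (· + v) '' P := by
      rintro x ⟨j, hj, y, hy, rfl⟩
      have hj : j ≤ 1 := hj
      interval_cases j
      · exact Or.inl (by simpa using hy)
      · exact Or.inr ⟨y, hy, by simp⟩
    calc _ ≤ (P ∪ (· + v) '' P).ncard := Set.ncard_le_ncard hsub (hP.union (hP.image _))
      _ ≤ P.ncard + ((· + v) '' P).ncard := Set.ncard_union_le _ _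
      _ ≤ P.ncard + P.ncard := Nat.add_le_add_left (Set.ncard_image_le hP) _
      _ ≤ 2 ^ (v :: F).length := by rw [List.length_cons, pow_succ]; omega

lemma eq_setOf_fin {n : ℕ} (L : List (ℕ × ℤ)) (hn : L.length ≤ n) :
    ∃ (q : Fin n → ℤ) (l : Fin n → ℕ), (∀ i, 0 < l i) ∧
      progression L =
        {z : ℤ | ∃ x : Fin n → ℕ, (∀ i, x i < l i) ∧ z = ∑ i, (x i : ℤ) * q i} := by
  induction n generalizing L with
  | zero =>
    obtain rfl : L = [] := List.length_eq_zero_iff.1 (by omega)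
    exact ⟨0, 0, fun i => i.elim0, by ext; simp [progression]⟩
  | succ n ih =>
    suffices ∃ (l : ℕ) (v : ℤ) (M : List (ℕ × ℤ)), M.length ≤ n ∧
        progression L = progression ((l, v) :: M) by
      obtain ⟨m, v, M, hM, h⟩ := this
      obtain ⟨q, l, hl, hq⟩ := ih M hM
      refine ⟨Fin.cons v q, Fin.cons (m + 1) l, Fin.cases (by simp) (by simpa using hl), ?_⟩
      rw [h]
      ext z
      simp only [progression, hq, Set.mem_ofPred_eq, Fin.sum_univ_succ, Fin.cons_zero,
        Fin.cons_succ]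
      constructor
      · rintro ⟨j, hj, _, ⟨x, hx, rfl⟩, rfl⟩
        refine ⟨Fin.cons j x, Fin.cases (by simpa using hj) (by simpa using hx), ?_⟩
        simp [add_comm]
      · rintro ⟨x, hx, rfl⟩
        refine ⟨x 0, by simpa [Nat.lt_succ_iff] using hx 0, _,
          ⟨fun i => x i.succ, fun i => by simpa using hx i.succ, rfl⟩, ?_⟩
        simp [add_comm]
    cases L with
    | nil => exact ⟨0, 0, [], by simp, by ext; simp [progression]⟩
    | cons p M => exact ⟨p.1, p.2, M, by simpa using hn, rfl⟩

end progression

open ZMod in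
/-- **Bogolyubov's lemma**: twice the difference set of `B` contains a Bohr set of rank at most
`(N / #B) ^ 2`. -/
lemma bogolyubov {N : ℕ} [NeZero N] {B : Finset (ZMod N)} (hB : B.Nonempty) :
    ∃ Γ : Finset (ZMod N), Γ.card * B.card ^ 2 ≤ N ^ 2 ∧
      ∀ x, (∀ r ∈ Γ, 0 ≤ (stdAddChar (x * r) : ℂ).re) →
        ∃ a ∈ B, ∃ b ∈ B, ∃ c ∈ B, ∃ d ∈ B, x = a + b - c - d := by
  classical
  have hprim := isPrimitive_stdAddChar N
  have hN : (0 : ℝ) < N := by exact_mod_cast NeZero.pos N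
  have hb : (0 : ℝ) < B.card := by exact_mod_cast hB.card_pos
  set χ : AddChar (ZMod N) ℂ := stdAddChar
  have hconj : ∀ t, starRingEnd ℂ (χ t) = χ (-t) := fun t => (AddChar.map_neg_eq_conj χ t).symm
  set F : ZMod N → ℂ := fun r => ∑ a ∈ B, χ (a * r)
  set w : ZMod N → ℝ := fun r => ‖F r‖ ^ 2
  have hw : ∀ r, (w r : ℂ) = ∑ a ∈ B, ∑ b ∈ B, χ (r * (a - b)) := by
    intro r
    have : (w r : ℂ) = F r * starRingEnd ℂ (F r) := by
      rw [Complex.mul_conj, Complex.normSq_eq_norm_sq]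
    rw [this, map_sum, Finset.sum_mul_sum]
    refine Finset.sum_congr rfl fun a _ => Finset.sum_congr rfl fun b _ => ?_
    rw [hconj, ← AddChar.map_add_eq_mul]
    congr 1; ring
  have hw0 : ∀ r, 0 ≤ w r := fun r => by positivity
  have hwzero : w 0 = (B.card : ℝ) ^ 2 := by simp [w, F]
  have parseval : ∑ r, w r = N * B.card := by
    have : ((∑ r, w r : ℝ) : ℂ) = ((N * B.card : ℝ) : ℂ) := by
      push_cast
      simp_rw [hw]
      rw [Finset.sum_comm]
      simp_rw [Finset.sum_comm (s := Finset.univ) (t := B), AddChar.sum_mulShift _ hprim,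
        sub_eq_zero, ZMod.card]
      simp [mul_comm]
    exact_mod_cast this
  set Γ : Finset (ZMod N) := {r | (B.card : ℝ) ^ 3 ≤ N * w r}
  refine ⟨Γ, ?_, fun x hx => ?_⟩
  · have h1 : (Γ.card : ℝ) * B.card ^ 3 ≤ N * (N * B.card) := by
      calc (Γ.card : ℝ) * B.card ^ 3 = ∑ r ∈ Γ, (B.card : ℝ) ^ 3 := by simp
        _ ≤ ∑ r ∈ Γ, N * w r := Finset.sum_le_sum fun r hr => (Finset.mem_filter.1 hr).2
        _ ≤ ∑ r, N * w r := Finset.sum_le_sum_of_subset_of_nonneg (Finset.subset_univ _)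
            fun r _ _ => by have := hw0 r; positivity
        _ = N * (N * B.card) := by rw [← Finset.mul_sum, parseval]
    have h2 : (Γ.card : ℝ) * B.card ^ 2 ≤ N ^ 2 := by
      refine le_of_mul_le_mul_right ?_ hb
      nlinarith
    exact_mod_cast h2
  · by_contra! hcon
    have hsum : ∑ r, (w r : ℂ) * w r * χ (x * r) = 0 := by
      have : ∀ r, (w r : ℂ) * w r * χ (x * r) =
          ∑ a ∈ B, ∑ c ∈ B, ∑ b ∈ B, ∑ d ∈ B, χ (r * (x - (b + d - a - c))) := by
        intro r
        simp_rw [hw r, Finset.sum_mul_sum, Finset.sum_mul]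
        refine Finset.sum_congr rfl fun a _ => Finset.sum_congr rfl fun c _ =>
          Finset.sum_congr rfl fun b _ => Finset.sum_congr rfl fun d _ => ?_
        rw [← AddChar.map_add_eq_mul, ← AddChar.map_add_eq_mul]
        congr 1; ring
      simp_rw [this]
      rw [Finset.sum_comm]
      refine Finset.sum_eq_zero fun a ha => ?_
      rw [Finset.sum_comm]
      refine Finset.sum_eq_zero fun c hc => ?_
      rw [Finset.sum_comm]
      refine Finset.sum_eq_zero fun b hb => ?_
      rw [Finset.sum_comm]
      refine Finset.sum_eq_zero fun d hd => ?_
      rw [AddChar.sum_mulShift _ hprim, if_neg]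
      · simp
      · rw [sub_eq_zero]; exact hcon b hb d hd a ha c hc
    have hre : ∑ r, w r * w r * (χ (x * r)).re = 0 := by
      have := congrArg Complex.re hsum
      rw [Complex.re_sum] at this
      rw [← Complex.zero_re, ← this]
      refine Finset.sum_congr rfl fun r _ => ?_
      rw [← Complex.ofReal_mul, Complex.re_ofReal_mul]
    have hre' : ∀ r, -1 ≤ (χ (x * r)).re := fun r => by
      have h1 := Complex.abs_re_le_norm (χ (x * r))
      rw [AddChar.norm_apply] at h1
      exact (abs_le.1 h1).1
    have key : ∀ r ≠ 0, -(B.card : ℝ) ^ 3 * w r ≤ N * (w r * w r * (χ (x * r)).re) := by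
      intro r _
      have h0 := hw0 r
      by_cases hr : r ∈ Γ
      · have h1 := hx r hr
        have : 0 ≤ N * (w r * w r * (χ (x * r)).re) := by positivity
        have : 0 ≤ (B.card : ℝ) ^ 3 * w r := by positivity
        linarith
      · have h1 : N * w r ≤ (B.card : ℝ) ^ 3 := by
          simpa [Γ] using (le_of_not_ge fun h => hr (by simpa [Γ] using h))
        have h2 := hre' r
        have h3 : N * w r * w r ≤ (B.card : ℝ) ^ 3 * w r := by gcongr
        have h4 : 0 ≤ N * w r * w r := by positivity
        nlinarith
    have htot : ∑ r ∈ Finset.univ.erase (0 : ZMod N), w r = N * B.card - B.card ^ 2 := by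
      rw [← parseval, ← hwzero, ← Finset.sum_erase_add _ _ (Finset.mem_univ (0 : ZMod N))]
      ring
    have hlow := Finset.sum_le_sum fun r (hr : r ∈ Finset.univ.erase (0 : ZMod N)) =>
      key r (Finset.ne_of_mem_erase hr)
    rw [← Finset.mul_sum, ← Finset.mul_sum, htot] at hlow
    rw [← Finset.sum_erase_add _ _ (Finset.mem_univ (0 : ZMod N)), hwzero] at hre
    simp only [mul_zero, AddChar.map_zero_eq_one, Complex.one_re, mul_one] at hre
    have : 0 < (B.card : ℝ) ^ 5 := by positivity
    nlinarith

lemma Finset.multiset_sum_mem_nsmul {G : Type*} [AddCommMonoid G] [DecidableEq G] {A : Finset G}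
    {s : Multiset G} (hs : ∀ x ∈ s, x ∈ A) : s.sum ∈ s.card • A := by
  induction s using Multiset.induction with
  | empty => simp
  | cons a s ih =>
    rw [Multiset.sum_cons, Multiset.card_cons, succ_nsmul']
    exact Finset.add_mem_add (hs a (by simp)) (ih fun x hx => hs x (by simp [hx]))

lemma card_dvd_val_mul_le {p : ℕ} [Fact p.Prime] (N : ℕ) {d : ZMod p} (hd : d ≠ 0) :
    ({q : ZMod p | q ≠ 0 ∧ N ∣ (q * d).val} : Finset (ZMod p)).card ≤ (p - 1) / N := by
  rw [← Nat.Ioc_filter_dvd_card_eq_div]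
  refine Finset.card_le_card_of_injOn (fun q => (q * d).val) ?_ ?_
  · intro q hq
    have hq : q ≠ 0 ∧ N ∣ (q * d).val := by simpa using hq
    have h1 : (q * d).val ≠ 0 := by simp [ZMod.val_eq_zero, hq.1, hd]
    have h2 := ZMod.val_lt (q * d)
    simp only [Finset.coe_filter, Finset.mem_Ioc, Set.mem_ofPred_eq]
    exact ⟨by omega, hq.2⟩
  · intro q _ q' _ h
    exact mul_right_cancel₀ hd (ZMod.val_injective p h)

/-- Modulo a large prime, some dilate of `D` has no nonzero element with residue divisible by
`#D`. -/
lemma exists_dilation (D : Finset ℤ) (h0 : (0 : ℤ) ∈ D) {p : ℕ} [hp : Fact p.Prime]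
    (hD : ∀ d ∈ D, d ≠ 0 → (d : ZMod p) ≠ 0) :
    ∃ q : ZMod p, ∀ d ∈ D, d ≠ 0 → ¬ D.card ∣ (q * d).val := by
  classical
  have hDpos : 0 < D.card := Finset.card_pos.2 ⟨0, h0⟩
  set bad : ℤ → Finset (ZMod p) := fun d => {q | q ≠ 0 ∧ D.card ∣ (q * d).val}
  have hlt : ((D.erase 0).biUnion bad).card < (Finset.univ.erase (0 : ZMod p)).card := by
    have h1 : ((D.erase 0).biUnion bad).card ≤ (D.erase 0).card * ((p - 1) / D.card) := by
      refine Finset.card_biUnion_le_card_mul _ _ _ fun d hd => ?_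
      rw [Finset.mem_erase] at hd
      exact card_dvd_val_mul_le _ (hD d hd.2 hd.1)
    rw [Finset.card_erase_of_mem h0] at h1
    rw [Finset.card_erase_of_mem (Finset.mem_univ _), Finset.card_univ, ZMod.card]
    have h2 := Nat.mul_div_le (p - 1) D.card
    have h3 := hp.out.two_le
    rcases Nat.eq_zero_or_pos ((p - 1) / D.card) with h | h
    · rw [h] at h1; omega
    · have : (D.card - 1) * ((p - 1) / D.card) < D.card * ((p - 1) / D.card) :=
        Nat.mul_lt_mul_of_pos_right (by omega) h
      omega
  obtain ⟨q, hq, hq'⟩ := Finset.exists_mem_notMem_of_card_lt_card hlt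
  refine ⟨q, fun d hd hd0 hdvd => hq' ?_⟩
  rw [Finset.mem_biUnion]
  exact ⟨d, Finset.mem_erase.2 ⟨hd0, hd⟩, by simpa [bad] using ⟨Finset.ne_of_mem_erase hq, hdvd⟩⟩

/-- **Ruzsa's modelling lemma**: a large piece of `A` is Freiman isomorphic of order `k` to a
subset of a cyclic group of order `#(k • A - k • A)`. -/
lemma exists_isAddFreimanIso_zmod {A : Finset ℤ} (hA : A.Nonempty) {k : ℕ} (hk : k ≠ 0) :
    ∃ A' ⊆ A, A.card ≤ k * A'.card ∧
      ∃ ψ : ℤ → ZMod (k • A - k • A).card,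
        IsAddFreimanIso k (A' : Set ℤ) (A'.image ψ : Set (ZMod (k • A - k • A).card)) ψ := by
  set D := k • A - k • A
  have hkA : (k • A).Nonempty := hA.nsmul
  have h0 : (0 : ℤ) ∈ D := by
    obtain ⟨x, hx⟩ := hkA
    exact sub_self x ▸ Finset.sub_mem_sub hx hx
  obtain ⟨p, hple, hp⟩ := Nat.exists_infinite_primes (D.sup Int.natAbs + 1)
  have : Fact p.Prime := ⟨hp⟩
  have hpD : ∀ d ∈ D, d ≠ 0 → (d : ZMod p) ≠ 0 := by
    intro d hd hd0 h
    rw [ZMod.intCast_zmod_eq_zero_iff_dvd] at h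
    have h1 := Int.natAbs_dvd_natAbs.2 h
    have h2 := Nat.le_of_dvd (by omega) h1
    have h3 : d.natAbs ≤ D.sup Int.natAbs := Finset.le_sup (f := Int.natAbs) hd
    simp at h2
    omega
  obtain ⟨q, hq⟩ := exists_dilation D h0 hpD
  set lift : ℤ → ℤ := fun a => (q * a : ZMod p).val
  have hp0 : 0 < p := hp.pos
  obtain ⟨j, -, hj⟩ : ∃ j ∈ Finset.range k,
      A.card ≤ k * (A.filter fun a : ℤ => k * (q * a : ZMod p).val / p = j).card := by
    by_contra! hcon
    have h1 : A.card = ∑ j ∈ Finset.range k,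
        (A.filter fun a : ℤ => k * (q * a : ZMod p).val / p = j).card := by
      refine Finset.card_eq_sum_card_fiberwise fun a _ => ?_
      simp only [Finset.coe_range, Set.mem_Iio]
      rw [Nat.div_lt_iff_lt_mul hp0]
      exact Nat.mul_lt_mul_of_pos_left (ZMod.val_lt _) (by omega)
    have h2 : ∑ j ∈ Finset.range k,
        k * (A.filter fun a : ℤ => k * (q * a : ZMod p).val / p = j).card <
        ∑ j ∈ Finset.range k, A.card :=
      Finset.sum_lt_sum_of_nonempty (by simpa using hk) hcon
    rw [← Finset.mul_sum, ← h1] at h2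
    simp at h2
  set A' := A.filter fun a : ℤ => k * (q * a : ZMod p).val / p = j
  refine ⟨A', Finset.filter_subset _ _, hj, fun a => (lift a : ℤ), ?_⟩
  have hsumlift : ∀ s : Multiset ℤ, (((s.map lift).sum : ℤ) : ZMod p) = q * (s.sum : ℤ) := by
    intro s
    induction s using Multiset.induction with
    | empty => simp
    | cons a s ih =>
      rw [Multiset.map_cons, Multiset.sum_cons, Multiset.sum_cons, Int.cast_add, ih, Int.cast_add,
        mul_add]
      simp [lift]
  have hbound : ∀ s : Multiset ℤ, (∀ a ∈ s, a ∈ A') →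
      s.card * (j * p : ℤ) ≤ k * (s.map lift).sum ∧
      k * (s.map lift).sum ≤ s.card * (j * p + p - 1 : ℤ) := by
    intro s
    induction s using Multiset.induction with
    | empty => simp
    | cons a s ih =>
      intro hs
      obtain ⟨h1, h2⟩ := ih fun x hx => hs x (by simp [hx])
      have ha : k * (q * a : ZMod p).val / p = j := (Finset.mem_filter.1 (hs a (by simp))).2
      obtain ⟨h3, h4⟩ := (Nat.div_eq_iff hp0).1 ha
      have h3 : (j * p : ℤ) ≤ k * lift a := by simp only [lift]; exact_mod_cast h3
      have h4 : k * lift a ≤ (j * p + p - 1 : ℤ) := by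
        have h5 : k * (q * a : ZMod p).val + 1 ≤ j * p + p := by omega
        have h5 : (k * lift a + 1 : ℤ) ≤ j * p + p := by simp only [lift]; exact_mod_cast h5
        linarith
      simp only [Multiset.map_cons, Multiset.sum_cons, Multiset.card_cons]
      push_cast
      constructor <;> nlinarith
  have hcast : ∀ s : Multiset ℤ, (s.map fun a => ((lift a : ℤ) : ZMod D.card)).sum =
      (((s.map lift).sum : ℤ) : ZMod D.card) := by
    intro s
    induction s using Multiset.induction with
    | empty => simp
    | cons a s ih =>
      rw [Multiset.map_cons, Multiset.sum_cons, ih, Multiset.map_cons, Multiset.sum_cons,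
        Int.cast_add]
  have key : ∀ s t : Multiset ℤ, (∀ a ∈ s, a ∈ A') → (∀ a ∈ t, a ∈ A') → s.card = k → t.card = k →
      ((s.map fun a => ((lift a : ℤ) : ZMod D.card)).sum =
        (t.map fun a => ((lift a : ℤ) : ZMod D.card)).sum ↔ s.sum = t.sum) := by
    intro s t hs ht hsk htk
    obtain ⟨hs1, hs2⟩ := hbound s hs
    obtain ⟨ht1, ht2⟩ := hbound t ht
    rw [hsk] at hs1 hs2
    rw [htk] at ht1 ht2
    have hkpos : (0 : ℤ) < k := by omega
    replace hs1 := le_of_mul_le_mul_left hs1 hkpos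
    replace hs2 := le_of_mul_le_mul_left hs2 hkpos
    replace ht1 := le_of_mul_le_mul_left ht1 hkpos
    replace ht2 := le_of_mul_le_mul_left ht2 hkpos
    have hsub : ∀ s t : Multiset ℤ, (s.map lift).sum - (t.map lift).sum < p →
        0 ≤ (s.map lift).sum - (t.map lift).sum →
        (s.map lift).sum - (t.map lift).sum = (q * ((s.sum - t.sum : ℤ) : ZMod p)).val := by
      intro s t hlt hnn
      have h1 : (((s.map lift).sum - (t.map lift).sum : ℤ) : ZMod p) =
          q * ((s.sum - t.sum : ℤ) : ZMod p) := by
        rw [Int.cast_sub, hsumlift, hsumlift, Int.cast_sub, mul_sub]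
      rw [← h1, ZMod.val_intCast, Int.emod_eq_of_lt hnn hlt]
    have hmemD : ∀ s t : Multiset ℤ, (∀ a ∈ s, a ∈ A') → (∀ a ∈ t, a ∈ A') → s.card = k →
        t.card = k → s.sum - t.sum ∈ D := by
      intro s t hs ht hsk htk
      refine Finset.sub_mem_sub ?_ ?_
      · rw [← hsk]
        exact Finset.multiset_sum_mem_nsmul fun x hx => (Finset.mem_filter.1 (hs x hx)).1
      · rw [← htk]
        exact Finset.multiset_sum_mem_nsmul fun x hx => (Finset.mem_filter.1 (ht x hx)).1
    rw [hcast, hcast]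
    constructor
    · intro h
      wlog hle : (t.map lift).sum ≤ (s.map lift).sum generalizing s t
      · exact (this t s ht hs htk hsk ht1 ht2 hs1 hs2 h.symm (by omega)).symm
      by_contra hne
      refine hq _ (hmemD s t hs ht hsk htk) (sub_ne_zero.2 hne) ?_
      rw [← Int.natCast_dvd_natCast, ← hsub s t (by omega) (by omega),
        ← ZMod.intCast_zmod_eq_zero_iff_dvd]
      rw [Int.cast_sub, h, sub_self]
    · intro h
      wlog hle : (t.map lift).sum ≤ (s.map lift).sum generalizing s t
      · exact (this t s ht hs htk hsk ht1 ht2 hs1 hs2 h.symm (by omega)).symm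
      have := hsub s t (by omega) (by omega)
      rw [h, sub_self, Int.cast_zero, mul_zero, ZMod.val_zero, Nat.cast_zero, sub_eq_zero] at this
      rw [this]
  refine ⟨⟨?_, ?_, ?_⟩, fun s t hs ht hsk htk => key s t hs ht hsk htk⟩
  · intro a ha
    simpa using ⟨a, ha, rfl⟩
  · intro a ha b hb hab
    have := (key (Multiset.replicate k a) (Multiset.replicate k b)
      (fun x hx => (Multiset.eq_of_mem_replicate hx) ▸ ha)
      (fun x hx => (Multiset.eq_of_mem_replicate hx) ▸ hb) (by simp) (by simp)).1 (by
        simp only [Multiset.map_replicate]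
        exact congrArg (fun z => (Multiset.replicate k z).sum) hab)
    simpa [hk] using this
  · simp [Set.SurjOn]

/-- A nonzero lattice has a shortest nonzero vector. -/
lemma exists_shortest {E : Type*} [NormedAddCommGroup E] (Λ : AddSubgroup E)
    (hfin : ∀ R : ℝ, {x | x ∈ Λ ∧ ‖x‖ ≤ R}.Finite) (hΛ : Λ ≠ ⊥) :
    ∃ v ∈ Λ, v ≠ 0 ∧ ∀ x ∈ Λ, x ≠ 0 → ‖v‖ ≤ ‖x‖ := by
  obtain ⟨w, hw, hw0⟩ := Λ.bot_or_exists_ne_zero.resolve_left hΛ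
  obtain ⟨v, ⟨⟨hv, hvw⟩, hv0⟩, hmin⟩ := Set.exists_min_image
    ({x | x ∈ Λ ∧ ‖x‖ ≤ ‖w‖} \ {0}) (‖·‖) ((hfin ‖w‖).sdiff) ⟨w, ⟨hw, le_rfl⟩, hw0⟩
  refine ⟨v, hv, hv0, fun x hx hx0 => ?_⟩
  rcases le_total ‖x‖ ‖w‖ with h | h
  · exact hmin x ⟨⟨hx, h⟩, hx0⟩
  · exact hvw.trans h

section ShortestVector

variable {E : Type*} [NormedAddCommGroup E] [NormedSpace ℝ E] {Λ : AddSubgroup E} {v : E}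

/-- A shortest nonzero vector `v` of a lattice generates its intersection with the line `ℝ ∙ v`. -/
lemma exists_int_of_smul_mem (hv : v ∈ Λ) (hv0 : v ≠ 0) (hmin : ∀ x ∈ Λ, x ≠ 0 → ‖v‖ ≤ ‖x‖)
    {t : ℝ} (ht : t • v ∈ Λ) : ∃ m : ℤ, t • v = m • v := by
  refine ⟨round t, ?_⟩
  by_contra hne
  have h1 := hmin (t • v - round t • v) (Λ.sub_mem ht (Λ.zsmul_mem hv _)) (sub_ne_zero.2 hne)
  rw [← Int.cast_smul_eq_zsmul ℝ, ← sub_smul, norm_smul, Real.norm_eq_abs] at h1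
  have h2 := abs_sub_round t
  have h3 := norm_pos_iff.2 hv0
  nlinarith

/-- If `v` is a shortest nonzero vector of a lattice, each class of the lattice modulo `ℝ ∙ v` has a
representative at most four times as long as the class. -/
lemma exists_lift_norm_le (hv : v ∈ Λ) (hv0 : v ≠ 0) (hmin : ∀ x ∈ Λ, x ≠ 0 → ‖v‖ ≤ ‖x‖)
    {x : E} (hx : x ∈ Λ) :
    ∃ y ∈ Λ, (Submodule.Quotient.mk y : E ⧸ Submodule.span ℝ {v}) = Submodule.Quotient.mk x ∧
      ‖y‖ ≤ 4 * ‖(Submodule.Quotient.mk x : E ⧸ Submodule.span ℝ {v})‖ := by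
  set S := Submodule.span ℝ {v}
  by_cases hxS : x ∈ S
  · exact ⟨0, Λ.zero_mem, ((Submodule.Quotient.mk_eq_zero S).2 hxS).symm, by simp⟩
  have hvpos := norm_pos_iff.2 hv0
  obtain ⟨m, hm, hlt⟩ := Submodule.Quotient.norm_mk_lt (Submodule.Quotient.mk x : E ⧸ S)
    (show 0 < ‖v‖ / 4 by positivity)
  obtain ⟨t, ht⟩ := Submodule.mem_span_singleton.1 ((Submodule.Quotient.eq S).1 hm)
  have hround : ‖x + round t • v‖ ≤ ‖m‖ + ‖v‖ / 2 := by
    have : x + round t • v = m - (t - round t) • v := by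
      rw [sub_smul, ht, Int.cast_smul_eq_zsmul]; abel
    rw [this]
    refine (norm_sub_le _ _).trans ?_
    rw [norm_smul, Real.norm_eq_abs]
    have := abs_sub_round t
    nlinarith
  have hmem : round t • v ∈ S := by
    rw [← Int.cast_smul_eq_zsmul ℝ]
    exact S.smul_mem _ (Submodule.mem_span_singleton_self v)
  have hyΛ : x + round t • v ∈ Λ := Λ.add_mem hx (Λ.zsmul_mem hv _)
  have hne : x + round t • v ≠ 0 := fun h => hxS <| by
    rw [eq_neg_of_add_eq_zero_left h]; exact S.neg_mem hmem
  refine ⟨_, hyΛ, ?_, ?_⟩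
  · rw [Submodule.Quotient.eq]; simpa using hmem
  · have := hmin _ hyΛ hne
    linarith

lemma ncard_fiber_le (hv : v ∈ Λ) (hv0 : v ≠ 0) (hmin : ∀ x ∈ Λ, x ≠ 0 → ‖v‖ ≤ ‖x‖) (R : ℝ)
    (z : E ⧸ Submodule.span ℝ {v}) :
    {x | (x ∈ Λ ∧ ‖x‖ ≤ R) ∧ (Submodule.Quotient.mk x : E ⧸ Submodule.span ℝ {v}) = z}.ncard ≤
      2 * (⌊2 * R / ‖v‖⌋₊ + 1) := by
  set F := {x | (x ∈ Λ ∧ ‖x‖ ≤ R) ∧ (Submodule.Quotient.mk x : E ⧸ Submodule.span ℝ {v}) = z}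
  rcases F.eq_empty_or_nonempty with h | ⟨x, ⟨hx, hxR⟩, hxz⟩
  · simp [h]
  set l := ⌊2 * R / ‖v‖⌋₊
  have hsub : F ⊆ (fun m : ℤ => x + m • v) '' (Finset.Icc (-(l : ℤ)) l : Finset ℤ) := by
    rintro y ⟨⟨hy, hyR⟩, hyz⟩
    obtain ⟨t, ht⟩ := Submodule.mem_span_singleton.1
      ((Submodule.Quotient.eq _).1 (hyz.trans hxz.symm))
    obtain ⟨m, hm⟩ := exists_int_of_smul_mem hv hv0 hmin (ht ▸ Λ.sub_mem hy hx)
    have hmv : m • v = y - x := by rw [← hm, ht]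
    refine ⟨m, ?_, by simp [hmv]⟩
    have h1 : |(m : ℝ)| * ‖v‖ ≤ 2 * R := by
      rw [← Real.norm_eq_abs, ← norm_smul, Int.cast_smul_eq_zsmul, hmv]
      linarith [norm_sub_le y x]
    have h2 : m.natAbs ≤ l := by
      refine Nat.le_floor ?_
      rw [le_div_iff₀ (norm_pos_iff.2 hv0), Nat.cast_natAbs, Int.cast_abs]
      exact h1
    simp only [Finset.coe_Icc, Set.mem_Icc]
    omega
  calc F.ncard ≤ _ := Set.ncard_le_ncard hsub ((Finset.finite_toSet _).image _)
    _ ≤ _ := Set.ncard_image_le (Finset.finite_toSet _)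
    _ ≤ _ := by rw [Set.ncard_coe_finset, Int.card_Icc]; omega

end ShortestVector

lemma mul_ncard_progression_le {G H : Type*} [AddCommGroup G] [AddCommGroup H] (φ : G →+ H)
    (L : List (ℕ × G)) {v : G} (hφv : φ v = 0) (hv : Function.Injective fun j : ℕ => j • v)
    (l : ℕ) :
    (l + 1) * (progression (L.map (Prod.map id φ))).ncard ≤ (progression ((l, v) :: L)).ncard := by
  rw [← progression.image_hom]
  have hlift : ∀ z ∈ φ '' progression L, ∃ y ∈ progression L, φ y = z := fun z hz => hz
  choose! s hs hφs using hlift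
  have hcard : ((Finset.range (l + 1) : Set ℕ) ×ˢ (φ '' progression L)).ncard =
      (l + 1) * (φ '' progression L).ncard := by
    rw [Set.ncard_prod, Set.ncard_coe_finset, Finset.card_range]
  rw [← hcard]
  refine Set.ncard_le_ncard_of_injOn (fun p => s p.2 + p.1 • v) ?_ ?_ (progression.finite _)
  · rintro ⟨j, z⟩ ⟨hj, hz⟩
    exact ⟨j, by simpa [Nat.lt_succ_iff] using hj, _, hs z hz, rfl⟩
  · rintro ⟨j, z⟩ ⟨hj, hz⟩ ⟨j', z'⟩ ⟨hj', hz'⟩ h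
    have h : s z + j • v = s z' + j' • v := h
    obtain rfl : z = z' := by
      have := congrArg φ h
      simpa [hφv, hφs z hz, hφs z' hz'] using this
    rw [hv (add_left_cancel h)]

/-- The largest possible norm of an element of a progression, bounded by the triangle inequality. -/
def progressionRadius {E : Type*} [Norm E] (L : List (ℕ × E)) : ℝ :=
  (L.map fun p => p.1 * ‖p.2‖).sum

lemma norm_le_progressionRadius {E : Type*} [NormedAddCommGroup E] (L : List (ℕ × E)) :
    ∀ x ∈ progression L, ‖x‖ ≤ progressionRadius L := by
  induction L with
  | nil => rintro x rfl; simp [progressionRadius]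
  | cons p L ih =>
    rintro x ⟨j, hj, y, hy, rfl⟩
    have h1 : ‖j • p.2‖ ≤ p.1 * ‖p.2‖ := norm_nsmul_le.trans (by gcongr)
    have := ih y hy
    have := norm_add_le y (j • p.2)
    simp only [progressionRadius, List.map_cons, List.sum_cons] at *
    linarith

lemma progression_subset_addSubgroup {G : Type*} [AddCommGroup G] (Λ : AddSubgroup G)
    (L : List (ℕ × G)) (hL : ∀ p ∈ L, p.2 ∈ Λ) : progression L ⊆ Λ := by
  induction L with
  | nil => rintro x rfl; exact Λ.zero_mem
  | cons p L ih =>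
    rintro x ⟨j, -, y, hy, rfl⟩
    exact Λ.add_mem (ih (fun p hp => hL p (by simp [hp])) hy) (Λ.nsmul_mem (hL p (by simp)) j)

/-- A lattice in a `d`-dimensional normed space contains a `d`-dimensional progression which is, up
to constants depending on `d` only, as large as and no wider than the ball of radius `R`. -/
lemma exists_progression_of_lattice (d : ℕ) {E : Type*} [NormedAddCommGroup E] [NormedSpace ℝ E]
    [FiniteDimensional ℝ E] (hd : Module.finrank ℝ E = d) (Λ : AddSubgroup E)
    (hfin : ∀ R : ℝ, {x | x ∈ Λ ∧ ‖x‖ ≤ R}.Finite) {R : ℝ} (hR : 0 ≤ R) :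
    ∃ L : List (ℕ × E), L.length ≤ d ∧ (∀ p ∈ L, p.2 ∈ Λ) ∧ progressionRadius L ≤ 6 ^ d * R ∧
      {x | x ∈ Λ ∧ ‖x‖ ≤ R}.ncard ≤ 2 ^ d * (progression L).ncard := by
  induction d generalizing E with
  | zero =>
    have : Subsingleton E := Module.finrank_zero_iff.1 hd
    refine ⟨[], by simp, by simp, by simpa [progressionRadius] using hR, ?_⟩
    simpa [progression] using Set.ncard_le_one_of_subsingleton {x : E | x ∈ Λ ∧ ‖x‖ ≤ R}
  | succ d ih =>
    by_cases hΛ : Λ = ⊥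
    · refine ⟨[], by simp, by simp, ?_, ?_⟩
      · simp only [progressionRadius, List.map_nil, List.sum_nil]
        positivity
      have h1 : {x | x ∈ Λ ∧ ‖x‖ ≤ R}.ncard ≤ ({0} : Set E).ncard :=
        Set.ncard_le_ncard (by rintro x ⟨hx, -⟩; simpa [hΛ] using hx)
      have h2 : 1 ≤ 2 ^ (d + 1) := Nat.one_le_two_pow
      simp only [Set.ncard_singleton, progression] at h1 ⊢
      omega
    obtain ⟨v, hv, hv0, hmin⟩ := exists_shortest Λ hfin hΛ
    have hvpos := norm_pos_iff.2 hv0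
    set S := Submodule.span ℝ {v}
    let π : E →+ E ⧸ S := S.mkQ.toAddMonoidHom
    have hπ : ∀ x, π x = Submodule.Quotient.mk x := fun _ => rfl
    have hπv : π v = 0 := (Submodule.Quotient.mk_eq_zero S).2 (Submodule.mem_span_singleton_self v)
    have hrank : Module.finrank ℝ (E ⧸ S) = d := by
      have h1 := S.finrank_quotient_add_finrank
      have h2 : Module.finrank ℝ S = 1 := finrank_span_singleton hv0
      omega
    have hlift : ∀ z ∈ Λ.map π, ∃ y ∈ Λ, π y = z ∧ ‖y‖ ≤ 4 * ‖z‖ := by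
      rintro _ ⟨x, hx, rfl⟩
      exact exists_lift_norm_le hv hv0 hmin hx
    choose! s hsΛ hπs hsnorm using hlift
    have hfin' : ∀ R : ℝ, {z | z ∈ Λ.map π ∧ ‖z‖ ≤ R}.Finite := by
      intro R
      refine ((hfin (4 * R)).image π).subset ?_
      rintro z ⟨hz, hzR⟩
      exact ⟨s z, ⟨hsΛ z hz, (hsnorm z hz).trans (by gcongr)⟩, hπs z hz⟩
    have hclosed : IsClosed (S : Set E) := S.closed_of_finiteDimensional
    obtain ⟨L, hlen, hLΛ, hrad, hcard⟩ := ih hrank (Λ.map π) hfin'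
    set l := ⌊2 * R / ‖v‖⌋₊
    set M := L.map (Prod.map id s)
    have hMπ : M.map (Prod.map id π) = L := by
      rw [List.map_map]
      refine (List.map_congr_left fun p hp => ?_).trans L.map_id
      exact Prod.ext rfl (hπs p.2 (hLΛ p hp))
    refine ⟨(l, v) :: M, by simpa [M] using hlen, ?_, ?_, ?_⟩
    · intro p hp
      rcases List.mem_cons.1 hp with rfl | hp
      · exact hv
      · obtain ⟨p', hp', rfl⟩ := List.mem_map.1 hp
        exact hsΛ _ (hLΛ p' hp')
    · have h1 : progressionRadius M ≤ 4 * progressionRadius L := by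
        simp only [progressionRadius, M, List.map_map, ← List.sum_map_mul_left]
        refine List.sum_le_sum fun p hp => ?_
        have := hsnorm p.2 (hLΛ p hp)
        simp only [Function.comp, Prod.map_fst, Prod.map_snd, id]
        nlinarith [Nat.cast_nonneg (α := ℝ) p.1]
      have h2 : l * ‖v‖ ≤ 2 * R := by
        rw [← le_div_iff₀ hvpos]
        exact Nat.floor_le (by positivity)
      have h3 : progressionRadius ((l, v) :: M) = l * ‖v‖ + progressionRadius M := by
        simp [progressionRadius]
      have h4 : R ≤ 6 ^ d * R := le_mul_of_one_le_left hR (one_le_pow₀ (by norm_num))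
      rw [h3, pow_succ]
      linarith
    · have h1 : {x | x ∈ Λ ∧ ‖x‖ ≤ R}.ncard ≤
          2 * (l + 1) * {z | z ∈ Λ.map π ∧ ‖z‖ ≤ R}.ncard := by
        classical
        rw [Set.ncard_eq_toFinset_card _ (hfin R), Set.ncard_eq_toFinset_card _ (hfin' R)]
        refine Finset.card_le_mul_card_image_of_maps_to (f := π) ?_ _ ?_
        · intro x hx
          rw [Set.Finite.mem_toFinset] at hx ⊢
          exact ⟨⟨x, hx.1, rfl⟩, (Submodule.Quotient.norm_mk_le S x).trans hx.2⟩
        · intro z _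
          refine le_trans (le_of_eq ?_) (ncard_fiber_le hv hv0 hmin R z)
          rw [← Set.ncard_coe_finset]
          congr 1
          ext x
          simp [hπ]
      have hinj : Function.Injective fun j : ℕ => j • v := by
        intro i j hij
        have : (i : ℝ) • v = (j : ℝ) • v := by simpa [Nat.cast_smul_eq_nsmul] using hij
        exact_mod_cast smul_left_injective ℝ hv0 this
      have h2 := mul_ncard_progression_le π M hπv hinj l
      rw [hMπ] at h2
      calc _ ≤ _ := h1
        _ ≤ 2 * (l + 1) * (2 ^ d * (progression L).ncard) := by gcongr
        _ = 2 ^ (d + 1) * ((l + 1) * (progression L).ncard) := by ring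
        _ ≤ _ := by gcongr

/-- The lattice of integer vectors congruent modulo `N` to a multiple of the vector
`(r)_{r ∈ S}`. -/
def bohrLattice {N : ℕ} (S : Finset (ZMod N)) : AddSubgroup (S → ℝ) where
  carrier := {x | ∃ k : ZMod N, ∀ r : S, ∃ z : ℤ, x r = z ∧ (z : ZMod N) = k * r}
  zero_mem' := ⟨0, fun r => ⟨0, by simp⟩⟩
  add_mem' := by
    rintro x y ⟨k, hk⟩ ⟨k', hk'⟩
    refine ⟨k + k', fun r => ?_⟩
    obtain ⟨z, hz, hzk⟩ := hk r
    obtain ⟨z', hz', hzk'⟩ := hk' r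
    exact ⟨z + z', by simp [hz, hz'], by simp [hzk, hzk', add_mul]⟩
  neg_mem' := by
    rintro x ⟨k, hk⟩
    refine ⟨-k, fun r => ?_⟩
    obtain ⟨z, hz, hzk⟩ := hk r
    exact ⟨-z, by simp [hz], by simp [hzk]⟩

lemma finite_bohrLattice_ball {N : ℕ} (S : Finset (ZMod N)) (R : ℝ) :
    {x | x ∈ bohrLattice S ∧ ‖x‖ ≤ R}.Finite := by
  classical
  refine ((Set.finite_Icc (fun _ : S => -⌈R⌉) (fun _ => ⌈R⌉)).image fun z r => (z r : ℝ)).subset ?_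
  rintro x ⟨⟨k, hk⟩, hxR⟩
  choose z hz _ using hk
  have hzR : ∀ r, |z r| ≤ ⌈R⌉ := by
    intro r
    have h1 := (norm_le_pi_norm x r).trans (hxR.trans (Int.le_ceil R))
    rw [hz r, Real.norm_eq_abs] at h1
    exact_mod_cast h1
  exact ⟨z, ⟨fun r => (abs_le.1 (hzR r)).1, fun r => (abs_le.1 (hzR r)).2⟩,
    funext fun r => (hz r).symm⟩

/-- Many points of the Bohr lattice have norm at most `N / M`, by the pigeonhole principle. -/
lemma le_pow_mul_ncard_bohrLattice_ball {N : ℕ} [NeZero N] {S : Finset (ZMod N)} (hS : 1 ∈ S)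
    {M : ℕ} (hM : 0 < M) :
    N ≤ M ^ S.card * {x | x ∈ bohrLattice S ∧ ‖x‖ ≤ (N : ℝ) / M}.ncard := by
  classical
  have hN : 0 < N := NeZero.pos N
  set f : ZMod N → (S → Fin M) := fun k r =>
    ⟨M * (k * r).val / N,
      (Nat.div_lt_iff_lt_mul hN).2 (Nat.mul_lt_mul_of_pos_left (ZMod.val_lt _) hM)⟩
  have h := Finset.card_le_mul_card_image_of_maps_to (s := Finset.univ) (t := Finset.univ) (f := f)
    (fun _ _ => Finset.mem_univ _) {x | x ∈ bohrLattice S ∧ ‖x‖ ≤ (N : ℝ) / M}.ncard ?_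
  · simpa [mul_comm] using h
  intro b _
  rcases Finset.eq_empty_or_nonempty {k ∈ Finset.univ | f k = b} with hb | ⟨k₀, hk₀⟩
  · rw [hb]; simp
  rw [← Set.ncard_coe_finset]
  refine Set.ncard_le_ncard_of_injOn
    (fun k r => ((k * r).val : ℝ) - ((k₀ * r).val : ℝ)) ?_ ?_ (finite_bohrLattice_ball _ _)
  · intro k hk
    have hfk : f k = f k₀ := by
      simp only [Finset.coe_filter, Set.mem_ofPred_eq, Finset.mem_filter] at hk hk₀
      rw [hk.2, hk₀.2]
    refine ⟨⟨k - k₀, fun r => ⟨(k * r).val - (k₀ * r).val, by push_cast; rfl, ?_⟩⟩, ?_⟩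
    · push_cast
      simp [sub_mul]
    · rw [pi_norm_le_iff_of_nonneg (by positivity)]
      intro r
      have h1 : M * (k * r).val / N = M * (k₀ * r).val / N := congrArg Fin.val (congrFun hfk r)
      have h2 := Nat.div_add_mod (M * (k * r).val) N
      have h3 := Nat.div_add_mod (M * (k₀ * r).val) N
      have h4 := Nat.mod_lt (M * (k * r).val) hN
      have h5 := Nat.mod_lt (M * (k₀ * r).val) hN
      rw [← h1] at h3
      have h6 : M * (k * r).val ≤ M * (k₀ * r).val + N := by omega
      have h7 : M * (k₀ * r).val ≤ M * (k * r).val + N := by omega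
      have h6 : (M * (k * r).val : ℝ) ≤ M * (k₀ * r).val + N := by exact_mod_cast h6
      have h7 : (M * (k₀ * r).val : ℝ) ≤ M * (k * r).val + N := by exact_mod_cast h7
      have hM' : (0 : ℝ) < M := by exact_mod_cast hM
      rw [Real.norm_eq_abs, abs_sub_le_iff, le_div_iff₀ hM', le_div_iff₀ hM']
      constructor <;> linarith
  · intro k _ k' _ hkk'
    have := congrFun hkk' ⟨1, hS⟩
    simp only [mul_one, sub_left_inj, Nat.cast_inj] at this
    exact ZMod.val_injective N this

lemma re_stdAddChar_nonneg {N : ℕ} [NeZero N] {z : ℤ} (hz : |(z : ℝ)| ≤ N / 4) :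
    0 ≤ (ZMod.stdAddChar (z : ZMod N) : ℂ).re := by
  have hN : (0 : ℝ) < N := by exact_mod_cast NeZero.pos N
  have h : 2 * Real.pi * Complex.I * z / N = ((2 * Real.pi * z / N : ℝ) : ℂ) * Complex.I := by
    push_cast; ring
  rw [ZMod.stdAddChar_coe, h, Complex.exp_ofReal_mul_I_re]
  refine Real.cos_nonneg_of_mem_Icc (abs_le.1 ?_)
  rw [abs_div, abs_mul, abs_of_pos Real.two_pi_pos, abs_of_pos hN, div_le_iff₀ hN]
  nlinarith [Real.pi_pos]

/-- A Bohr set of rank `d` in `ℤ/N` contains a progression of dimension at most `d + 1` whose size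
is at least a fixed proportion of `N`. -/
lemma exists_progression_subset_bohr {N : ℕ} [NeZero N] (Γ : Finset (ZMod N)) {d : ℕ}
    (hd : Γ.card + 1 ≤ d) :
    ∃ L : List (ℕ × ZMod N), L.length ≤ d ∧
      (∀ x ∈ progression L, ∀ r ∈ Γ, 0 ≤ (ZMod.stdAddChar (x * r) : ℂ).re) ∧
      N ≤ (8 * 6 ^ d) ^ d * (progression L).ncard := by
  classical
  have hN : (0 : ℝ) < N := by exact_mod_cast NeZero.pos N
  set S := insert 1 Γ
  have hS : (1 : ZMod N) ∈ S := Finset.mem_insert_self _ _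
  have hcard : S.card ≤ d := (Finset.card_insert_le _ _).trans hd
  set M := 4 * 6 ^ S.card
  have hM : 0 < M := by positivity
  obtain ⟨L, hlen, hLΛ, hrad, hL⟩ := exists_progression_of_lattice S.card
    (by simp) (bohrLattice S) (finite_bohrLattice_ball S) (R := (N : ℝ) / M) (by positivity)
  replace hrad : progressionRadius L ≤ N / 4 := by
    refine hrad.trans (le_of_eq ?_)
    simp only [M]; push_cast; field_simp
  set κ : (S → ℝ) → ZMod N := fun x => (⌊x ⟨1, hS⟩⌋ : ZMod N)
  have hκ : ∀ x ∈ bohrLattice S, ∀ r : S, ∃ z : ℤ, x r = z ∧ (z : ZMod N) = κ x * r := by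
    rintro x ⟨k, hk⟩ r
    obtain ⟨z, hz, hzk⟩ := hk ⟨1, hS⟩
    have : κ x = k := by simp only [κ, hz, Int.floor_intCast, hzk, mul_one]
    rw [this]
    exact hk r
  have hadd : ∀ x ∈ bohrLattice S, ∀ y ∈ bohrLattice S, x + y ∈ bohrLattice S →
      κ (x + y) = κ x + κ y := by
    intro x hx y hy _
    obtain ⟨z, hz, -⟩ := hκ x hx ⟨1, hS⟩
    simp only [κ, Pi.add_apply, hz, Int.floor_intCast_add, Int.cast_add, Int.floor_intCast]
  have hsub := progression_subset_addSubgroup (bohrLattice S) L hLΛ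
  have hbound : ∀ x ∈ progression L, ∀ r, |x r| ≤ N / 4 := fun x hx r =>
    (norm_le_pi_norm x r).trans ((norm_le_progressionRadius L x hx).trans hrad)
  have himage := progression.image_eq hadd L hsub
  have hinj : Set.InjOn κ (progression L) := by
    intro x hx y hy hxy
    funext r
    obtain ⟨z, hz, hzr⟩ := hκ x (hsub hx) r
    obtain ⟨z', hz', hzr'⟩ := hκ y (hsub hy) r
    have h1 := hbound x hx r
    have h2 := hbound y hy r
    rw [hz] at h1
    rw [hz'] at h2
    have h3 : (N : ℤ) ∣ z - z' := by
      rw [← ZMod.intCast_zmod_eq_zero_iff_dvd, Int.cast_sub, hzr, hzr', hxy, sub_self]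
    have h4 : |z - z'| < N := by
      have : |(z - z' : ℝ)| < N := by linarith [abs_sub (z : ℝ) z']
      exact_mod_cast this
    rw [hz, hz', sub_eq_zero.1 (Int.eq_zero_of_abs_lt_dvd h3 h4)]
  refine ⟨L.map (Prod.map id κ), by simpa using hlen.trans hcard, ?_, ?_⟩
  · rw [← himage]
    rintro _ ⟨x, hx, rfl⟩ r hr
    obtain ⟨z, hz, hzr⟩ := hκ x (hsub hx) ⟨r, Finset.mem_insert_of_mem hr⟩
    rw [← hzr]
    exact re_stdAddChar_nonneg (hz ▸ hbound x hx _)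
  · rw [← himage, hinj.ncard_image]
    calc N ≤ M ^ S.card * _ := le_pow_mul_ncard_bohrLattice_ball hS hM
      _ ≤ M ^ S.card * (2 ^ S.card * (progression L).ncard) := by gcongr
      _ = (8 * 6 ^ S.card) ^ S.card * (progression L).ncard := by
        rw [← mul_assoc, ← mul_pow]; simp only [M]; ring
      _ ≤ (8 * 6 ^ d) ^ d * (progression L).ncard := by
        gcongr ?_ * _
        have h6 : 0 < 6 ^ d := by positivity
        calc (8 * 6 ^ S.card) ^ S.card ≤ (8 * 6 ^ d) ^ S.card := by gcongr; norm_num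
          _ ≤ (8 * 6 ^ d) ^ d := Nat.pow_le_pow_right (by omega) hcard

/-- The inverse of a Freiman isomorphism of order `6` extends to a map which is additive and
injective on the second difference set. -/
lemma IsAddFreimanIso.exists_additive_inverse {G H : Type*} [AddCommGroup G] [AddCommGroup H]
    {A : Set G} {B : Set H} {ψ : G → H} (hψ : IsAddFreimanIso 6 A B ψ) :
    ∃ Φ : H → G, Set.MapsTo Φ (B + B - B - B) (A + A - A - A) ∧
      Set.InjOn Φ (B + B - B - B) ∧
      ∀ x ∈ B + B - B - B, ∀ y ∈ B + B - B - B, x + y ∈ B + B - B - B →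
        Φ (x + y) = Φ x + Φ y := by
  have hrep : ∀ x ∈ B + B - B - B, ∃ a b c d, a ∈ A ∧ b ∈ A ∧ c ∈ A ∧ d ∈ A ∧
      x = ψ a + ψ b - ψ c - ψ d := by
    rintro _ ⟨_, ⟨_, ⟨_, ha', _, hb', rfl⟩, _, hc', rfl⟩, _, hd', rfl⟩
    obtain ⟨a, ha, rfl⟩ := hψ.bijOn.surjOn ha'
    obtain ⟨b, hb, rfl⟩ := hψ.bijOn.surjOn hb'
    obtain ⟨c, hc, rfl⟩ := hψ.bijOn.surjOn hc'
    obtain ⟨d, hd, rfl⟩ := hψ.bijOn.surjOn hd'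
    exact ⟨a, b, c, d, ha, hb, hc, hd, rfl⟩
  choose! a b c d ha hb hc hd hx using hrep
  have six : ∀ p₁ ∈ A, ∀ p₂ ∈ A, ∀ p₃ ∈ A, ∀ p₄ ∈ A, ∀ p₅ ∈ A, ∀ p₆ ∈ A,
      ∀ q₁ ∈ A, ∀ q₂ ∈ A, ∀ q₃ ∈ A, ∀ q₄ ∈ A, ∀ q₅ ∈ A, ∀ q₆ ∈ A,
      ψ p₁ + (ψ p₂ + (ψ p₃ + (ψ p₄ + (ψ p₅ + ψ p₆)))) =
        ψ q₁ + (ψ q₂ + (ψ q₃ + (ψ q₄ + (ψ q₅ + ψ q₆)))) ↔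
      p₁ + (p₂ + (p₃ + (p₄ + (p₅ + p₆)))) = q₁ + (q₂ + (q₃ + (q₄ + (q₅ + q₆)))) := by
    intros
    simpa using hψ.map_sum_eq_map_sum (s := {_, _, _, _, _, _}) (t := {_, _, _, _, _, _})
      (by simp [*]) (by simp [*]) (by simp) (by simp)
  refine ⟨fun x => a x + b x - c x - d x, ?_, ?_, ?_⟩
  · exact fun x h => Set.sub_mem_sub (Set.sub_mem_sub (Set.add_mem_add (ha x h) (hb x h)) (hc x h))
      (hd x h)
  · intro x h y h' hxy
    have hxy : a x + b x - c x - d x = a y + b y - c y - d y := hxy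
    have := (six _ (ha x h) _ (hb x h) _ (hc y h') _ (hd y h') _ (ha x h) _ (ha x h)
      _ (ha y h') _ (hb y h') _ (hc x h) _ (hd x h) _ (ha x h) _ (ha x h)).2
        (sub_eq_zero.1 (Eq.trans (by abel) (sub_eq_zero.2 hxy)))
    rw [hx x h, hx y h']
    exact sub_eq_zero.1 (Eq.trans (by abel) (sub_eq_zero.2 this))
  · intro x h y h' h''
    have e : ψ (a x) + ψ (b x) - ψ (c x) - ψ (d x) + (ψ (a y) + ψ (b y) - ψ (c y) - ψ (d y)) =
        ψ (a (x + y)) + ψ (b (x + y)) - ψ (c (x + y)) - ψ (d (x + y)) := by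
      rw [← hx x h, ← hx y h', ← hx _ h'']
    have := (six _ (ha x h) _ (hb x h) _ (ha y h') _ (hb y h') _ (hc _ h'') _ (hd _ h'')
      _ (hc x h) _ (hd x h) _ (hc y h') _ (hd y h') _ (ha _ h'') _ (hb _ h'')).1
        (sub_eq_zero.1 (Eq.trans (by abel) (sub_eq_zero.2 e)))
    exact sub_eq_zero.1 (Eq.trans (by dsimp only; abel) (sub_eq_zero.2 this.symm))

/-- The Plünnecke-Ruzsa inequality in terms of the doubling constant. -/
lemma card_nsmul_sub_nsmul_le {A : Finset ℤ} (hA : A.Nonempty) {c : ℝ}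
    (h : ((A + A).card : ℝ) ≤ c * A.card) (m n : ℕ) :
    ((m • A - n • A).card : ℝ) ≤ c ^ (m + n) * A.card := by
  have hpos : (0 : ℝ) < A.card := by exact_mod_cast hA.card_pos
  have h1 : ((m • A - n • A).card : ℝ) ≤ ((A + A).card / A.card : ℝ) ^ (m + n) * A.card := by
    have := (NNRat.cast_le (K := ℝ)).2
      (Finset.pluennecke_ruzsa_inequality_nsmul_sub_nsmul_add hA A m n)
    push_cast at this
    exact this
  refine h1.trans ?_
  gcongr
  rwa [div_le_iff₀ hpos]

/-- If `A` has small doubling, then `2A - 2A` contains a progression of bounded dimension whose size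
is at least a fixed proportion of `#A`. -/
lemma exists_progression_subset_sub {c : ℝ} (hc : 1 ≤ c) :
    ∃ D K : ℕ, ∀ A : Finset ℤ, A.Nonempty → ((A + A).card : ℝ) ≤ c * A.card →
      ∃ L : List (ℕ × ℤ), L.length ≤ D ∧
        progression L ⊆ (A + A - A - A : Set ℤ) ∧
        A.card ≤ K * (progression L).ncard := by
  set D := ⌊36 * c ^ 24⌋₊ + 1
  refine ⟨D, 6 * (8 * 6 ^ D) ^ D, fun A hA hAc => ?_⟩
  obtain ⟨A', hA'A, hA'card, ψ, hψ⟩ := exists_isAddFreimanIso_zmod hA (k := 6) (by norm_num)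
  have hN := card_nsmul_sub_nsmul_le hA hAc 6 6
  have hNpos : 0 < (6 • A - 6 • A).card := (hA.nsmul.sub hA.nsmul).card_pos
  generalize (6 • A - 6 • A).card = N at *
  have : NeZero N := ⟨hNpos.ne'⟩
  set B := A'.image ψ
  have hBcard : B.card = A'.card := Finset.card_image_of_injOn hψ.bijOn.injOn
  have hApos := hA.card_pos
  have hBpos : 0 < B.card := by omega
  have hBN : B.card ≤ N := by simpa using B.card_le_univ
  obtain ⟨Γ, hΓ, hbog⟩ := bogolyubov (Finset.card_pos.1 hBpos)
  have hΓD : Γ.card + 1 ≤ D := by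
    refine Nat.succ_le_succ (Nat.le_floor ?_)
    have h1 : (N : ℝ) ≤ 6 * c ^ 12 * B.card := by
      have h2 : (A.card : ℝ) ≤ 6 * B.card := by rw [hBcard]; exact_mod_cast hA'card
      calc (N : ℝ) ≤ c ^ 12 * A.card := hN
        _ ≤ c ^ 12 * (6 * B.card) := by gcongr
        _ = _ := by ring
    have h2 : (Γ.card : ℝ) * B.card ^ 2 ≤ N ^ 2 := by exact_mod_cast hΓ
    have h3 : (0 : ℝ) < B.card ^ 2 := by positivity
    refine le_of_mul_le_mul_right ?_ h3
    calc (Γ.card : ℝ) * B.card ^ 2 ≤ N ^ 2 := h2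
      _ ≤ (6 * c ^ 12 * B.card) ^ 2 := by gcongr
      _ = 36 * c ^ 24 * B.card ^ 2 := by ring
  obtain ⟨L, hlen, hLΓ, hL⟩ := exists_progression_subset_bohr Γ hΓD
  obtain ⟨Φ, hmaps, hinj, hadd⟩ := hψ.exists_additive_inverse
  have hsub : progression L ⊆ (B + B - B - B : Set (ZMod N)) := by
    intro x hx
    obtain ⟨a, ha, b, hb, c, hc, d, hd, rfl⟩ := hbog x (hLΓ x hx)
    exact Set.sub_mem_sub (Set.sub_mem_sub (Set.add_mem_add ha hb) hc) hd
  refine ⟨L.map (Prod.map id Φ), by simpa using hlen, ?_, ?_⟩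
  · rw [← progression.image_eq hadd L hsub]
    have hAA : (A' : Set ℤ) ⊆ A := hA'A
    exact (Set.image_mono hsub).trans (hmaps.image_subset.trans (by gcongr))
  · rw [← progression.image_eq hadd L hsub, (hinj.mono hsub).ncard_image]
    calc A.card ≤ 6 * N := by omega
      _ ≤ 6 * ((8 * 6 ^ D) ^ D * (progression L).ncard) := by gcongr
      _ = _ := by ring

/-- **Freiman's theorem.** For every real `c ≥ 1` there exist a positive integer `n` and a
real constant `c'` (depending only on `c`) such that every finite nonempty set `A ⊆ ℤ` with
`|A+A| ≤ c·|A|` is contained in an `n`-dimensional arithmetic progression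
`Q = {a + x₁q₁ + ⋯ + xₙqₙ : 0 ≤ xᵢ < lᵢ}` with `|Q| ≤ c'·|A|`. -/
theorem freiman_theorem (c : ℝ) (hc : 1 ≤ c) :
    ∃ (n : ℕ) (c' : ℝ), 0 < n ∧
      ∀ A : Finset ℤ, A.Nonempty → ((A + A).card : ℝ) ≤ c * A.card →
        ∃ (a : ℤ) (q : Fin n → ℤ) (l : Fin n → ℕ),
          (∀ i, 0 < l i) ∧
          (A : Set ℤ) ⊆
            {z : ℤ | ∃ x : Fin n → ℕ, (∀ i, x i < l i) ∧ z = a + ∑ i, (x i : ℤ) * q i} ∧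
          (({z : ℤ | ∃ x : Fin n → ℕ, (∀ i, x i < l i) ∧
              z = a + ∑ i, (x i : ℤ) * q i}.ncard : ℝ)) ≤ c' * A.card := by
  obtain ⟨D, K, hDK⟩ := exists_progression_subset_sub hc
  set m := ⌊K * c ^ 5⌋₊
  refine ⟨m + 2 * D + 1, 2 ^ m * c ^ 8, by omega, fun A hA hAc => ?_⟩
  obtain ⟨L, hlen, hLA, hcard⟩ := hDK A hA hAc
  set Q := (progression.finite L).toFinset
  have hQ : (Q : Set ℤ) = progression L := Set.Finite.coe_toFinset _
  have hQA : Q ⊆ 2 • A - 2 • A := by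
    rw [← Finset.coe_subset, hQ]
    refine hLA.trans (le_of_eq ?_)
    rw [two_nsmul, Finset.coe_sub, Finset.coe_add, sub_sub]
  have hQcard : Q.card = (progression L).ncard := by rw [← hQ, Set.ncard_coe_finset]
  have hQne : Q.Nonempty := ⟨0, by simpa [Q] using progression.zero_mem L⟩
  have hAQ : ((A + Q).card : ℝ) ≤ K * c ^ 5 * Q.card := by
    have hsub : A + Q ⊆ 3 • A - 2 • A := by
      rw [succ_nsmul' A 2, add_sub_assoc]
      exact Finset.add_subset_add_left hQA
    calc ((A + Q).card : ℝ) ≤ (3 • A - 2 • A).card := by exact_mod_cast Finset.card_le_card hsub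
      _ ≤ c ^ 5 * A.card := card_nsmul_sub_nsmul_le hA hAc 3 2
      _ ≤ c ^ 5 * (K * Q.card) := by rw [hQcard]; gcongr; exact_mod_cast hcard
      _ = K * c ^ 5 * Q.card := by ring
  obtain ⟨F, -, hF, hAF⟩ := Finset.ruzsa_covering_add hQne hAQ
  have hFm : F.card ≤ m := Nat.le_floor hF
  set cube := F.toList.map fun v => (1, v)
  have hprog : progression (cube ++ (L ++ L.map (Prod.map id Neg.neg))) =
      progression cube + ((Q - Q : Finset ℤ) : Set ℤ) := by
    rw [progression.append, progression.append, ← progression.neg_eq, ← sub_eq_add_neg,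
      Finset.coe_sub, hQ]
  obtain ⟨q, l, hl, heq⟩ := progression.eq_setOf_fin (n := m + 2 * D + 1)
    (cube ++ (L ++ L.map (Prod.map id Neg.neg))) (by simp [cube]; omega)
  refine ⟨0, q, l, hl, ?_, ?_⟩
  · simp only [zero_add]
    rw [← heq, hprog]
    intro x hx
    obtain ⟨f, hf, y, hy, rfl⟩ := Finset.mem_add.1 (hAF hx)
    exact Set.add_mem_add (progression.mem_cube (Finset.mem_toList.2 hf)) hy
  · simp only [zero_add]
    rw [← heq, hprog]
    have hQQ : Q - Q ⊆ 4 • A - 4 • A := by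
      refine (Finset.sub_subset_sub hQA hQA).trans (subset_of_eq ?_)
      rw [show 4 = 2 + 2 from rfl, add_nsmul, sub_sub_eq_add_sub,
        sub_add_eq_add_sub, sub_sub]
    have h1 : (progression cube + ((Q - Q : Finset ℤ) : Set ℤ)).ncard ≤
        2 ^ m * (4 • A - 4 • A).card := by
      calc _ ≤ (progression cube).ncard * ((Q - Q : Finset ℤ) : Set ℤ).ncard := Set.natCard_add_le
        _ ≤ 2 ^ F.toList.length * (Q - Q).card := by
          rw [Set.ncard_coe_finset]; gcongr; exact progression.ncard_cube_le _
        _ ≤ 2 ^ m * (4 • A - 4 • A).card := by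
          rw [Finset.length_toList]; gcongr; norm_num
    calc _ ≤ ((2 ^ m * (4 • A - 4 • A).card : ℕ) : ℝ) := by exact_mod_cast h1
      _ ≤ 2 ^ m * (c ^ 8 * A.card) := by
        push_cast; gcongr; exact card_nsmul_sub_nsmul_le hA hAc 4 4
      _ = 2 ^ m * c ^ 8 * A.card := by ring
end

section
/- Let A = {a₀, a₁, …, a_{k−1}} be a finite subset of ℤⁿ with k elements. Define λ(A) to be the dimension over ℚ of the linear span in ℚᵏ of the set of vectors e_i + e_j − e_r − e_s taken over all index quadruples (i, j, r, s) with a_i + a_j = a_r + a_s, where e₀, …, e_{k−1} is the standard basis of ℚᵏ. Then the Freiman dimension of A equals k − 1 − λ(A). -/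
/-- `φ` is a Freiman isomorphism of order 2 from the set `A` onto the set `B`. -/
def IsFreimanIso2 {G H : Type*} [AddCommGroup G] [AddCommGroup H]
    (A : Set G) (B : Set H) (φ : G → H) : Prop :=
  Set.BijOn φ A B ∧
  ∀ a₁ ∈ A, ∀ a₂ ∈ A, ∀ a₃ ∈ A, ∀ a₄ ∈ A,
    (a₁ + a₂ = a₃ + a₄ ↔ φ a₁ + φ a₂ = φ a₃ + φ a₄)

/-- `B ⊆ ℤ^d` is not contained in any affine hyperplane of `ℚ^d`. -/
def NotInAffineHyperplane {d : ℕ} (B : Set (Fin d → ℤ)) : Prop :=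
  ¬ ∃ (f : Fin d → ℚ) (cst : ℚ), f ≠ 0 ∧ ∀ b ∈ B, ∑ i, f i * (b i : ℚ) = cst

/-- The Freiman dimension of `A` is `d`: `d` is the largest `n` such that `A` is Freiman
isomorphic of order 2 to a subset of `ℤ^n` not contained in any affine hyperplane. -/
def HasFreimanDim {G : Type*} [AddCommGroup G] (A : Set G) (d : ℕ) : Prop :=
  IsGreatest {n : ℕ | ∃ (B : Set (Fin n → ℤ)) (φ : G → (Fin n → ℤ)),
    IsFreimanIso2 A B φ ∧ NotInAffineHyperplane B} d

/-- The space of rational functions on the index set of `a` that respect all additive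
quadruples of `a`. -/
def freimanFunctions {G : Type*} [AddCommGroup G] {k : ℕ} (a : Fin k → G) :
    Submodule ℚ (Fin k → ℚ) where
  carrier := {x | ∀ i j r s, a i + a j = a r + a s → x i + x j = x r + x s}
  add_mem' := by
    intro x y hx hy i j r s h
    have h₁ := hx i j r s h
    have h₂ := hy i j r s h
    simp only [Pi.add_apply]
    linarith
  zero_mem' := by
    intro i j r s _
    simp
  smul_mem' := by
    intro c x hx i j r s h
    have h₁ := hx i j r s h
    simp only [Pi.smul_apply, smul_eq_mul, ← mul_add, h₁]

theorem mem_freimanFunctions {G : Type*} [AddCommGroup G] {k : ℕ} {a : Fin k → G}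
    {x : Fin k → ℚ} : x ∈ freimanFunctions a ↔
      ∀ i j r s, a i + a j = a r + a s → x i + x j = x r + x s :=
  Iff.rfl

theorem one_mem_freimanFunctions {G : Type*} [AddCommGroup G] {k : ℕ} (a : Fin k → G) :
    (1 : Fin k → ℚ) ∈ freimanFunctions a :=
  fun _ _ _ _ _ => rfl

theorem finrank_span_add_finrank_freimanFunctions {G : Type*} [AddCommGroup G] {k : ℕ}
    (a : Fin k → G) :
    Module.finrank ℚ (Submodule.span ℚ
      {v : Fin k → ℚ | ∃ i j r s : Fin k, a i + a j = a r + a s ∧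
        v = Pi.single i 1 + Pi.single j 1 - Pi.single r 1 - Pi.single s 1}) +
      Module.finrank ℚ (freimanFunctions a) = k := by
  set W := Submodule.span ℚ
      {v : Fin k → ℚ | ∃ i j r s : Fin k, a i + a j = a r + a s ∧
        v = Pi.single i 1 + Pi.single j 1 - Pi.single r 1 - Pi.single s 1} with hW
  let e : (Fin k → ℚ) ≃ₗ[ℚ] Module.Dual ℚ (Fin k → ℚ) := (Pi.basisFun ℚ (Fin k)).toDualEquiv
  have he : ∀ x i, e x (Pi.single i 1) = x i := by
    intro x i
    have := (Pi.basisFun ℚ (Fin k)).toDual_eq_repr x i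
    simpa [e] using this
  have hL : freimanFunctions a =
      W.dualAnnihilator.comap (e : (Fin k → ℚ) →ₗ[ℚ] Module.Dual ℚ (Fin k → ℚ)) := by
    ext x
    rw [mem_freimanFunctions, Submodule.mem_comap, Submodule.mem_dualAnnihilator]
    constructor
    · intro h w hw
      have hle : W ≤ LinearMap.ker (e x) := by
        rw [hW, Submodule.span_le]
        rintro v ⟨i, j, r, s, hq, rfl⟩
        have := h i j r s hq
        simp only [SetLike.mem_coe, LinearMap.mem_ker, map_add, map_sub, he]
        linarith
      exact hle hw
    · intro h i j r s hq
      have := h _ (Submodule.subset_span ⟨i, j, r, s, hq, rfl⟩)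
      simp only [LinearEquiv.coe_coe, map_add, map_sub, he] at this
      linarith
  have hfin : Module.finrank ℚ (freimanFunctions a) = Module.finrank ℚ W.dualAnnihilator := by
    rw [hL]
    exact (e.ofSubmodule' W.dualAnnihilator).finrank_eq
  rw [hfin, Subspace.finrank_add_finrank_dualAnnihilator_eq, Module.finrank_fin_fun]

/-- A Freiman isomorphism onto a set not contained in a hyperplane yields, together with the
constants, linearly independent elements of `freimanFunctions a`. -/
theorem add_one_le_finrank_freimanFunctions {G : Type*} [AddCommGroup G] {k m : ℕ} [NeZero k]
    {a : Fin k → G} {B : Set (Fin m → ℤ)} {φ : G → Fin m → ℤ}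
    (hφ : IsFreimanIso2 (Set.range a) B φ) (hB : NotInAffineHyperplane B) :
    m + 1 ≤ Module.finrank ℚ (freimanFunctions a) := by
  have hmem : ∀ t, (fun i => (φ (a i) t : ℚ)) ∈ freimanFunctions a := by
    intro t i j r s h
    have := congrFun ((hφ.2 _ ⟨i, rfl⟩ _ ⟨j, rfl⟩ _ ⟨r, rfl⟩ _ ⟨s, rfl⟩).1 h) t
    simp only [Pi.add_apply] at this
    change (φ (a i) t : ℚ) + φ (a j) t = φ (a r) t + φ (a s) t
    exact_mod_cast this
  let v : Option (Fin m) → freimanFunctions a := fun o =>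
    o.elim ⟨1, one_mem_freimanFunctions a⟩ fun t => ⟨_, hmem t⟩
  have hv : LinearIndependent ℚ v := by
    rw [Fintype.linearIndependent_iff]
    intro g hg
    have hpt : ∀ i, g none + ∑ t, g (some t) * (φ (a i) t : ℚ) = 0 := by
      intro i
      have := congrFun (congrArg Subtype.val hg) i
      simpa [Fintype.sum_option, v] using this
    have hsome : (fun t => g (some t)) = 0 := by
      by_contra hne
      refine hB ⟨_, -g none, hne, fun b hb => ?_⟩
      obtain ⟨_, ⟨i, rfl⟩, rfl⟩ := hφ.1.surjOn hb
      linarith [hpt i]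
    have hs : ∀ t, g (some t) = 0 := congrFun hsome
    rintro (_ | t)
    · simpa [hs] using hpt 0
    · exact hs t
  simpa using hv.fintype_card_le_finrank

theorem exists_basis_fin_succ_apply_zero {K V : Type*} [Field K] [AddCommGroup V] [Module K V]
    [FiniteDimensional K V] {u : V} (hu : u ≠ 0) :
    ∃ (m : ℕ) (b : Module.Basis (Fin (m + 1)) K V), b 0 = u := by
  obtain ⟨C, hC⟩ := Submodule.exists_isCompl (Submodule.span K {u})
  refine ⟨Module.finrank K C, Module.Basis.mkFinCons u (Module.finBasis K C) ?_ ?_, ?_⟩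
  · intro c x hx h
    have hcu : c • u ∈ C := by
      rw [eq_neg_of_add_eq_zero_left h]
      exact C.neg_mem hx
    have := Submodule.disjoint_def.1 hC.disjoint _
      (Submodule.smul_mem _ c (Submodule.mem_span_singleton_self u)) hcu
    exact (smul_eq_zero.1 this).resolve_right hu
  · intro z
    have hz : z ∈ Submodule.span K {u} ⊔ C := by
      rw [hC.sup_eq_top]
      trivial
    obtain ⟨p, hp, q, hq, rfl⟩ := Submodule.mem_sup.1 hz
    obtain ⟨c, rfl⟩ := Submodule.mem_span_singleton.1 hp
    exact ⟨-c, by simpa using hq⟩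
  · rw [Module.Basis.coe_mkFinCons]
    rfl

/-- A basis of `freimanFunctions a` containing the constant function `1` gives the coordinates of
a Freiman isomorphism from `Set.range a` onto a set not contained in a hyperplane. -/
theorem exists_isFreimanIso2_of_finrank {n k : ℕ} [NeZero k] {a : Fin k → Fin n → ℤ}
    (ha : Function.Injective a) :
    ∃ m : ℕ, m + 1 = Module.finrank ℚ (freimanFunctions a) ∧
      ∃ (B : Set (Fin m → ℤ)) (φ : (Fin n → ℤ) → Fin m → ℤ),
        IsFreimanIso2 (Set.range a) B φ ∧ NotInAffineHyperplane B := by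
  let u : freimanFunctions a := ⟨1, one_mem_freimanFunctions a⟩
  have hu : u ≠ 0 := by
    intro h
    have := congrFun (congrArg Subtype.val h) 0
    simp [u] at this
  obtain ⟨m, b, hb0⟩ := exists_basis_fin_succ_apply_zero (K := ℚ) hu
  refine ⟨m, by simp [Module.finrank_eq_card_basis b], ?_⟩
  let y : Fin m → Fin k → ℚ := fun t => (b t.succ).1
  obtain ⟨N, hN⟩ := IsLocalization.exist_integer_multiples_of_finite (nonZeroDivisors ℤ)
    (fun p : Fin m × Fin k => y p.1 p.2)
  have hN0 : ((N : ℤ) : ℚ) ≠ 0 := by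
    exact_mod_cast nonZeroDivisors.coe_ne_zero N
  have hz' : ∀ t i, ∃ z : ℤ, (z : ℚ) = ((N : ℤ) : ℚ) * y t i := by
    intro t i
    obtain ⟨z, hz⟩ := hN (t, i)
    exact ⟨z, by simpa using hz⟩
  choose z hz using hz'
  let φ : (Fin n → ℤ) → Fin m → ℤ := Function.extend a (fun i t => z t i) 0
  have hφ : ∀ i, φ (a i) = fun t => z t i := fun i => ha.extend_apply _ _ i
  have hforward : ∀ i j r s, a i + a j = a r + a s →
      φ (a i) + φ (a j) = φ (a r) + φ (a s) := by
    intro i j r s h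
    simp only [hφ]
    funext t
    have h₁ : y t i + y t j = y t r + y t s := (b t.succ).2 i j r s h
    have : (z t i : ℚ) + z t j = z t r + z t s := by
      simp only [hz, ← mul_add, h₁]
    exact_mod_cast this
  have hbackward : ∀ i j r s, φ (a i) + φ (a j) = φ (a r) + φ (a s) →
      a i + a j = a r + a s := by
    intro i j r s h
    have hy : ∀ t, y t i + y t j = y t r + y t s := by
      intro t
      have h₁ := congrFun h t
      simp only [hφ, Pi.add_apply] at h₁
      have h₂ : (z t i : ℚ) + z t j = z t r + z t s := by exact_mod_cast h₁
      simp only [hz, ← mul_add] at h₂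
      exact mul_left_cancel₀ hN0 h₂
    let π : Fin k → (Fin k → ℚ) →ₗ[ℚ] ℚ := fun q => LinearMap.proj q
    let ℓ : (Fin k → ℚ) →ₗ[ℚ] ℚ := π i + π j - π r - π s
    have hker : ℓ.comp (freimanFunctions a).subtype = 0 := by
      refine b.ext fun t => ?_
      refine Fin.cases ?_ (fun t => ?_) t
      · rw [hb0]
        change (1 : ℚ) + 1 - 1 - 1 = 0
        norm_num
      · change y t i + y t j - y t r - y t s = 0
        linarith [hy t]
    funext t
    have hat : (fun i => (a i t : ℚ)) ∈ freimanFunctions a := by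
      intro i j r s h
      have := congrFun h t
      simp only [Pi.add_apply] at this
      change (a i t : ℚ) + a j t = a r t + a s t
      exact_mod_cast this
    have h₁ : (a i t : ℚ) + a j t - a r t - a s t = 0 :=
      LinearMap.congr_fun hker ⟨_, hat⟩
    have h₂ : (a i t : ℚ) + a j t = a r t + a s t := by linarith
    exact_mod_cast h₂
  refine ⟨φ '' Set.range a, φ, ⟨Set.InjOn.bijOn_image ?_, ?_⟩, ?_⟩
  · rintro _ ⟨i, rfl⟩ _ ⟨j, rfl⟩ h
    exact add_right_cancel (hbackward i i j i (by rw [h]))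
  · rintro _ ⟨i, rfl⟩ _ ⟨j, rfl⟩ _ ⟨r, rfl⟩ _ ⟨s, rfl⟩
    exact ⟨hforward i j r s, hbackward i j r s⟩
  · rintro ⟨f, c, hf, hfc⟩
    apply hf
    have hzero : ∑ t, (Fin.cons (-c) fun t => f t * ((N : ℤ) : ℚ) : Fin (m + 1) → ℚ) t • b t
        = 0 := by
      apply Subtype.ext
      funext i
      have := hfc _ ⟨_, ⟨i, rfl⟩, rfl⟩
      simp only [hφ, hz] at this
      have hsum : -c + ∑ t, f t * ((N : ℤ) : ℚ) * y t i = 0 := by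
        simp only [mul_assoc, this, neg_add_cancel]
      simpa [Fin.sum_univ_succ, hb0, u, y] using hsum
    funext t
    have := Fintype.linearIndependent_iff.1 b.linearIndependent _ hzero t.succ
    rw [Fin.cons_succ] at this
    exact (mul_eq_zero.1 this).resolve_right hN0

/-- **Konyagin–Lev theorem.** For a set `A = {a 0, …, a (k-1)} ⊆ ℤⁿ` of `k` elements, the
Freiman dimension of `A` equals `k - 1 - λ(A)`, where `λ(A)` is the dimension over `ℚ` of
the span of the vectors `e_i + e_j - e_r - e_s` over all quadruples with
`a i + a j = a r + a s`. -/
theorem konyagin_lev (n k : ℕ) (a : Fin k → (Fin n → ℤ)) (ha : Function.Injective a)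
    (d : ℕ) (hd : HasFreimanDim (Set.range a) d) :
    d = k - 1 - Module.finrank ℚ (Submodule.span ℚ
      {v : Fin k → ℚ | ∃ i j r s : Fin k, a i + a j = a r + a s ∧
        v = Pi.single i 1 + Pi.single j 1 - Pi.single r 1 - Pi.single s 1}) := by
  rcases Nat.eq_zero_or_pos k with rfl | hk
  · obtain ⟨B, φ, hφ, hB⟩ := hd.1
    rcases Nat.eq_zero_or_pos d with rfl | hdpos
    · simp
    · refine absurd ⟨fun _ => 1, 0, ?_, fun b hb => ?_⟩ hB
      · intro h
        exact one_ne_zero (congrFun h ⟨0, hdpos⟩)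
      · obtain ⟨_, ⟨i, _⟩, _⟩ := hφ.1.surjOn hb
        exact i.elim0
  · have : NeZero k := ⟨hk.ne'⟩
    have hsum := finrank_span_add_finrank_freimanFunctions a
    obtain ⟨B, φ, hφ, hB⟩ := hd.1
    have hle := add_one_le_finrank_freimanFunctions hφ hB
    obtain ⟨m, hm, hmem⟩ := exists_isFreimanIso2_of_finrank ha
    have hge : m ≤ d := hd.2 hmem
    omega
end

section
/- Let h₁ ≥ 2 and 0 ≤ b ≤ h₁ − 2 be integers, and let A = A' ∪ A'' ⊂ ℤ², where A' ⊆ {(x, 0) : 0 ≤ x ≤ h₁ − 1}, A'' ⊆ {(x, 1) : 0 ≤ x ≤ b}, and (0,0) ∈ A', (h₁ − 1, 0) ∈ A', (0,1) ∈ A''. Let φ(x, y) = x + 2(h₁ − 1)y and A₁ = φ(A). Then |A₁ + A₁| = |A + A| − 1. -/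
open Pointwise

/-- If a map `f` identifies a point `q` of `S` with another point `p` of `S`, and is injective
on `S \ {q}`, then the image of `S` has exactly one element fewer than `S`. -/
lemma card_image_eq_pred_of_injOn_erase {α β : Type*} [DecidableEq α] [DecidableEq β]
    {S : Finset α} {f : α → β} {p q : α} (hp : p ∈ S) (hq : q ∈ S) (hpq : p ≠ q)
    (hf : f p = f q) (hinj : Set.InjOn f (S.erase q)) :
    (S.image f).card = S.card - 1 := by
  rw [← Finset.card_erase_of_mem hq, ← Finset.card_image_of_injOn hinj]
  congr 1
  rw [← Finset.insert_erase hq, Finset.image_insert, Finset.erase_insert_eq_erase,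
    Finset.erase_idem, ← hf]
  exact Finset.insert_eq_of_mem (Finset.mem_image_of_mem f (Finset.mem_erase.2 ⟨hpq, hp⟩))

/-- Location of the sums of two points of a two-line configuration. -/
lemma mem_two_lines_add {L b : ℤ} {A' A'' : Finset (ℤ × ℤ)}
    (hA' : ∀ p ∈ A', 0 ≤ p.1 ∧ p.1 ≤ L ∧ p.2 = 0)
    (hA'' : ∀ p ∈ A'', 0 ≤ p.1 ∧ p.1 ≤ b ∧ p.2 = 1)
    {s : ℤ × ℤ} (hs : s ∈ (A' ∪ A'') + (A' ∪ A'')) :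
    0 ≤ s.1 ∧ (s.2 = 0 ∧ s.1 ≤ 2 * L ∨ s.2 = 1 ∧ s.1 ≤ L + b ∨ s.2 = 2 ∧ s.1 ≤ 2 * b) := by
  obtain ⟨u, hu, v, hv, rfl⟩ := Finset.mem_add.1 hs
  rw [Prod.fst_add, Prod.snd_add]
  rcases Finset.mem_union.1 hu with hu | hu <;> rcases Finset.mem_union.1 hv with hv | hv
  · have := hA' u hu; have := hA' v hv; omega
  · have := hA' u hu; have := hA'' v hv; omega
  · have := hA'' u hu; have := hA' v hv; omega
  · have := hA'' u hu; have := hA'' v hv; omega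

/-- For a two-line configuration `A = A' ∪ A''` with `A'` on the line `y = 0`,
`0 ≤ x ≤ h₁ - 1`, `A''` on the line `y = 1`, `0 ≤ x ≤ b ≤ h₁ - 2`, containing the points
`(0,0)`, `(h₁ - 1, 0)` and `(0,1)`, the image `A₁` of `A` under the projection
`φ(x, y) = x + 2(h₁ - 1)y` satisfies `|A₁ + A₁| = |A + A| - 1`. -/
theorem two_lines_doubling_drop (h₁ b : ℤ) (hh₁ : 2 ≤ h₁) (hb0 : 0 ≤ b) (hb : b ≤ h₁ - 2)
    (A' A'' : Finset (ℤ × ℤ))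
    (hA' : ∀ p ∈ A', 0 ≤ p.1 ∧ p.1 ≤ h₁ - 1 ∧ p.2 = 0)
    (hA'' : ∀ p ∈ A'', 0 ≤ p.1 ∧ p.1 ≤ b ∧ p.2 = 1)
    (h00 : ((0 : ℤ), (0 : ℤ)) ∈ A')
    (hh0 : ((h₁ - 1, 0) : ℤ × ℤ) ∈ A')
    (h01 : ((0 : ℤ), (1 : ℤ)) ∈ A'') :
    (((A' ∪ A'').image (fun p : ℤ × ℤ => p.1 + 2 * (h₁ - 1) * p.2)) +
        ((A' ∪ A'').image (fun p : ℤ × ℤ => p.1 + 2 * (h₁ - 1) * p.2))).card =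
      ((A' ∪ A'') + (A' ∪ A'')).card - 1 := by
  have himage : ((A' ∪ A'').image (fun p : ℤ × ℤ => p.1 + 2 * (h₁ - 1) * p.2)) +
      ((A' ∪ A'').image (fun p : ℤ × ℤ => p.1 + 2 * (h₁ - 1) * p.2)) =
      ((A' ∪ A'') + (A' ∪ A'')).image (fun p : ℤ × ℤ => p.1 + 2 * (h₁ - 1) * p.2) :=
    (Finset.image_image₂_distrib fun u v => by
      simp only [Prod.fst_add, Prod.snd_add]; ring).symm
  rw [himage]
  have hp : ((2 * (h₁ - 1), 0) : ℤ × ℤ) ∈ (A' ∪ A'') + (A' ∪ A'') :=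
    Finset.mem_add.2 ⟨_, Finset.mem_union_left _ hh0, _, Finset.mem_union_left _ hh0, by
      ext <;> simp [two_mul]⟩
  have hq : ((0, 1) : ℤ × ℤ) ∈ (A' ∪ A'') + (A' ∪ A'') :=
    Finset.mem_add.2 ⟨_, Finset.mem_union_left _ h00, _, Finset.mem_union_right _ h01, by simp⟩
  refine card_image_eq_pred_of_injOn_erase hp hq (by simp) (by simp) ?_
  rintro ⟨x, y⟩ hs ⟨x', y'⟩ ht hst
  obtain ⟨hs0, hs⟩ := Finset.mem_erase.1 hs
  obtain ⟨ht0, ht⟩ := Finset.mem_erase.1 ht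
  have hs := mem_two_lines_add hA' hA'' hs
  have ht := mem_two_lines_add hA' hA'' ht
  simp only [ne_eq, Prod.mk.injEq] at hs hs0 ht ht0 hst ⊢
  rcases hs with ⟨hx, ⟨rfl, _⟩ | ⟨rfl, _⟩ | ⟨rfl, _⟩⟩ <;>
    rcases ht with ⟨hx', ⟨rfl, _⟩ | ⟨rfl, _⟩ | ⟨rfl, _⟩⟩ <;> omega
end

section
/- Let h₁ ≥ 3 and 0 ≤ b ≤ h₁ − 1 be integers, and let A = A' ∪ A'' ⊂ ℤ², where A' ⊆ {(x, 0) : 0 ≤ x ≤ h₁ − 1}, A'' ⊆ {(x, 1) : 0 ≤ x ≤ b}, with (0,0), (h₁−1, 0) ∈ A' and (0,1), (b,1) ∈ A''. Let φ(x, y) = x + 2(h₁ − 1)y. Then the number of integers in the interval [min φ(A), max φ(A)] equals 2h₁ − 1 + b, the number of lattice points of ℤ² in the convex hull of A equals h₁ + b + 1, and 2h₁ − 1 + b > h₁ + b + 1. -/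
/-- A convex subset of the plane meets each horizontal line in an interval. -/
theorem Convex.ordConnected_horizontal_section {S : Set (ℝ × ℝ)} (hS : Convex ℝ S) (y : ℝ) :
    {x : ℝ | (x, y) ∈ S}.OrdConnected := by
  refine Convex.ordConnected (𝕜 := ℝ) fun u hu v hv s t hs ht hst => ?_
  have h := hS hu hv hs ht hst
  have hy : s * y + t * y = y := by rw [← add_mul, hst, one_mul]
  simpa [hy] using h

/-- The trapezoid with vertices `(0, 0)`, `(c, 0)`, `(d, 1)`, `(0, 1)` is convex. -/
theorem convex_trapezoid (c d : ℝ) :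
    Convex ℝ {p : ℝ × ℝ | 0 ≤ p.2 ∧ p.2 ≤ 1 ∧ 0 ≤ p.1 ∧ p.1 + p.2 * (c - d) ≤ c} := by
  rintro ⟨x, y⟩ ⟨h1, h2, h3, h4⟩ ⟨u, v⟩ ⟨k1, k2, k3, k4⟩ s t hs ht hst
  simp only [Prod.smul_mk, Prod.mk_add_mk, smul_eq_mul, Set.mem_ofPred_eq] at *
  refine ⟨by positivity, ?_, by positivity, ?_⟩
  · calc s * y + t * v ≤ s * 1 + t * 1 := by gcongr
      _ = 1 := by linarith
  · calc s * x + t * u + (s * y + t * v) * (c - d)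
        = s * (x + y * (c - d)) + t * (u + v * (c - d)) := by ring
      _ ≤ s * c + t * c := by gcongr
      _ = c := by rw [← add_mul, hst, one_mul]

/-- For a two-line configuration `A = A' ∪ A''` with `A'` on the line `y = 0`,
`0 ≤ x ≤ h₁ - 1`, `A''` on the line `y = 1`, `0 ≤ x ≤ b`, containing `(0,0)`, `(h₁-1,0)`,
`(0,1)` and `(b,1)`, and `φ(x,y) = x + 2(h₁-1)y`: the number of integers in
`[min φ(A), max φ(A)]` is `2h₁ - 1 + b`, the number of lattice points of `ℤ²` in the convex
hull of `A` is `h₁ + b + 1`, and `2h₁ - 1 + b > h₁ + b + 1`. -/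
theorem two_lines_volume (h₁ b : ℤ) (hh₁ : 3 ≤ h₁) (hb0 : 0 ≤ b) (hb : b ≤ h₁ - 1)
    (A' A'' : Finset (ℤ × ℤ))
    (hA' : ∀ p ∈ A', 0 ≤ p.1 ∧ p.1 ≤ h₁ - 1 ∧ p.2 = 0)
    (hA'' : ∀ p ∈ A'', 0 ≤ p.1 ∧ p.1 ≤ b ∧ p.2 = 1)
    (h00 : ((0 : ℤ), (0 : ℤ)) ∈ A')
    (hh0 : ((h₁ - 1, 0) : ℤ × ℤ) ∈ A')
    (h01 : ((0 : ℤ), (1 : ℤ)) ∈ A'')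
    (hb1 : ((b, 1) : ℤ × ℤ) ∈ A'')
    (hne : ((A' ∪ A'').image (fun p : ℤ × ℤ => p.1 + 2 * (h₁ - 1) * p.2)).Nonempty) :
    ((Finset.Icc
        (((A' ∪ A'').image (fun p : ℤ × ℤ => p.1 + 2 * (h₁ - 1) * p.2)).min' hne)
        (((A' ∪ A'').image (fun p : ℤ × ℤ => p.1 + 2 * (h₁ - 1) * p.2)).max' hne)).card : ℤ)
      = 2 * h₁ - 1 + b ∧
    ({q : ℤ × ℤ | ((q.1 : ℝ), (q.2 : ℝ)) ∈
        convexHull ℝ ((fun p : ℤ × ℤ => ((p.1 : ℝ), (p.2 : ℝ))) ''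
          (↑(A' ∪ A'') : Set (ℤ × ℤ)))}.ncard : ℤ) = h₁ + b + 1 ∧
    2 * h₁ - 1 + b > h₁ + b + 1 := by
  refine ⟨?_, ?_, by linarith⟩
  · have hmin : ((A' ∪ A'').image (fun p : ℤ × ℤ => p.1 + 2 * (h₁ - 1) * p.2)).min' hne = 0 := by
      refine le_antisymm
        (Finset.min'_le _ _ (Finset.mem_image.2 ⟨_, Finset.mem_union_left _ h00, by simp⟩))
        (Finset.le_min' _ _ _ fun z hz => ?_)
      obtain ⟨p, hp, rfl⟩ := Finset.mem_image.1 hz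
      rcases Finset.mem_union.1 hp with hp | hp
      · obtain ⟨hx, -, hy⟩ := hA' p hp
        simpa [hy] using hx
      · obtain ⟨hx, -, hy⟩ := hA'' p hp
        simp only [hy]
        linarith
    have hmax : ((A' ∪ A'').image (fun p : ℤ × ℤ => p.1 + 2 * (h₁ - 1) * p.2)).max' hne
        = 2 * h₁ - 2 + b := by
      refine le_antisymm (Finset.max'_le _ _ _ fun z hz => ?_)
        (Finset.le_max' _ _ (Finset.mem_image.2 ⟨_, Finset.mem_union_right _ hb1, by ring⟩))
      obtain ⟨p, hp, rfl⟩ := Finset.mem_image.1 hz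
      rcases Finset.mem_union.1 hp with hp | hp
      · obtain ⟨-, hx, hy⟩ := hA' p hp
        simp only [hy]
        linarith
      · obtain ⟨-, hx, hy⟩ := hA'' p hp
        simp only [hy]
        linarith
    rw [hmin, hmax, Int.card_Icc]
    omega
  · set S := convexHull ℝ ((fun p : ℤ × ℤ => ((p.1 : ℝ), (p.2 : ℝ))) ''
      (↑(A' ∪ A'') : Set (ℤ × ℤ)))
    have hS : Convex ℝ S := convex_convexHull ℝ _
    have hmem : ∀ p ∈ A' ∪ A'', ((p.1 : ℝ), (p.2 : ℝ)) ∈ S := fun p hp =>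
      subset_convexHull ℝ _ ⟨p, hp, rfl⟩
    have hsub : S ⊆ {p : ℝ × ℝ | 0 ≤ p.2 ∧ p.2 ≤ 1 ∧ 0 ≤ p.1 ∧
        p.1 + p.2 * (((h₁ - 1 : ℤ) : ℝ) - (b : ℝ)) ≤ ((h₁ - 1 : ℤ) : ℝ)} := by
      refine convexHull_min ?_ (convex_trapezoid _ _)
      rintro _ ⟨p, hp, rfl⟩
      simp only [Set.mem_ofPred_eq]
      rcases Finset.mem_union.1 (Finset.mem_coe.1 hp) with hp | hp
      · obtain ⟨h0, hx, hy⟩ := hA' p hp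
        rw [hy]
        norm_cast
        omega
      · obtain ⟨h0, hx, hy⟩ := hA'' p hp
        rw [hy]
        norm_cast
        omega
    have hset : {q : ℤ × ℤ | ((q.1 : ℝ), (q.2 : ℝ)) ∈ S}
        = ↑(Finset.Icc 0 (h₁ - 1) ×ˢ {0} ∪ Finset.Icc 0 b ×ˢ {1} : Finset (ℤ × ℤ)) := by
      ext ⟨x, y⟩
      simp only [Set.mem_ofPred_eq, Finset.coe_union, Set.mem_union, Finset.mem_coe,
        Finset.mem_product, Finset.mem_Icc, Finset.mem_singleton]
      constructor
      · intro hq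
        obtain ⟨h1, h2, h3, h4⟩ : (0 : ℝ) ≤ y ∧ (y : ℝ) ≤ 1 ∧ (0 : ℝ) ≤ x ∧
            (x : ℝ) + y * (((h₁ - 1 : ℤ) : ℝ) - (b : ℝ)) ≤ ((h₁ - 1 : ℤ) : ℝ) := hsub hq
        norm_cast at h1 h2 h3 h4
        obtain rfl | rfl : y = 0 ∨ y = 1 := by omega
        all_goals omega
      · rintro (⟨⟨hx0, hx⟩, rfl⟩ | ⟨⟨hx0, hx⟩, rfl⟩)
        · have hl := hmem _ (Finset.mem_union_left _ h00)
          have hr := hmem _ (Finset.mem_union_left _ hh0)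
          exact (hS.ordConnected_horizontal_section ((0 : ℤ) : ℝ)).out hl hr
            ⟨Int.cast_le.2 hx0, Int.cast_le.2 hx⟩
        · have hl := hmem _ (Finset.mem_union_right _ h01)
          have hr := hmem _ (Finset.mem_union_right _ hb1)
          exact (hS.ordConnected_horizontal_section ((1 : ℤ) : ℝ)).out hl hr
            ⟨Int.cast_le.2 hx0, Int.cast_le.2 hx⟩
    rw [hset, Set.ncard_coe_finset, Finset.card_union_of_disjoint]
    · simp only [Finset.card_product, Int.card_Icc, Finset.card_singleton]
      omega
    · exact Finset.disjoint_product.2 (Or.inr (by simp))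
end

section
/- Let k ≥ 3 be an integer and let T be an integer with 2k − 1 ≤ T ≤ (k² − k)/2 + 2. Then there exist integers c and b with 2 ≤ c ≤ k − 1 and 0 ≤ b ≤ k − c − 1 such that 2T = 2ck − (c² + c − 4) + 2b. -/
/-- The intervals `[ck - (c² + c - 4)/2, ck - (c² + c - 4)/2 + k - c - 1]` for `2 ≤ c ≤ m`
cover every `T` between `2k - 1` and the left endpoint of the last one. -/
theorem exists_representation_of_le (k T : ℤ) (hT : 2 * k - 1 ≤ T) (m : ℤ) (hm : 2 ≤ m) :
    m ≤ k - 1 → 2 * T ≤ 2 * m * k - (m ^ 2 + m - 4) →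
    ∃ c b : ℤ, 2 ≤ c ∧ c ≤ k - 1 ∧ 0 ≤ b ∧ b ≤ k - c - 1 ∧
      2 * T = 2 * c * k - (c ^ 2 + c - 4) + 2 * b := by
  induction m, hm using Int.leInduction with
  | base =>
    intro hk h
    exact ⟨2, 0, by omega, by omega, by omega, by omega, by linarith⟩
  | succ m hm ih =>
    intro hk h
    by_cases h' : 2 * T ≤ 2 * m * k - (m ^ 2 + m - 4)
    · exact ih (by omega) h'
    · obtain ⟨r, hr⟩ := Int.even_mul_succ_self m
      refine ⟨m, T - m * k + r - 2, hm, by omega, ?_, ?_, ?_⟩ <;> nlinarith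

/-- Every integer `T` with `2k - 1 ≤ T ≤ (k² - k)/2 + 2` (where `k ≥ 3`) admits a
representation `T = ck - (c² + c - 4)/2 + b` with `2 ≤ c ≤ k - 1` and `0 ≤ b ≤ k - c - 1`. -/
theorem T_representation (k T : ℤ) (hk : 3 ≤ k)
    (hT1 : 2 * k - 1 ≤ T) (hT2 : T ≤ (k ^ 2 - k) / 2 + 2) :
    ∃ c b : ℤ, 2 ≤ c ∧ c ≤ k - 1 ∧ 0 ≤ b ∧ b ≤ k - c - 1 ∧
      2 * T = 2 * c * k - (c ^ 2 + c - 4) + 2 * b := by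
  refine exists_representation_of_le k T hT1 (k - 1) (by omega) le_rfl ?_
  have h : 2 * T ≤ k ^ 2 - k + 4 := by omega
  linarith
end

section
/- Let k, c, b be integers with 2 ≤ c ≤ k − 1 and 0 ≤ b ≤ k − c − 1. Then there exists a finite set A ⊂ ℤ with |A| = k, min A = 0, max A = 2^{c−2}·(k + 1 − c + b), the greatest common divisor of the elements of A equal to 1, and |A + A| = ck − (c² + c − 4)/2 + b. -/
open Pointwise

/-- Adjoining twice the maximum `m` to a set of nonnegative integers containing `0` enlarges the
sumset by the cardinality of the new set minus one. -/
theorem card_add_insert_two_mul_max {A : Finset ℤ} {m : ℤ} (hm0 : 0 < m) (h0 : 0 ∈ A) (hm : m ∈ A)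
    (hA : ∀ x ∈ A, 0 ≤ x ∧ x ≤ m) :
    (insert (2 * m) A + insert (2 * m) A).card = (A + A).card + A.card := by
  have hnot : 2 * m ∉ A := fun h => by linarith [(hA _ h).2]
  have key : insert (2 * m) A + insert (2 * m) A =
      (A + A) ∪ ((insert (2 * m) A).erase 0).image (2 * m + ·) := by
    ext x
    simp only [Finset.mem_add, Finset.mem_union, Finset.mem_image, Finset.mem_erase,
      Finset.mem_insert]
    constructor
    · rintro ⟨y, hy, z, hz, rfl⟩
      rcases hy with rfl | hy
      · by_cases hz0 : z = 0
        · exact Or.inl ⟨m, hm, m, hm, by linarith⟩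
        · exact Or.inr ⟨z, ⟨hz0, hz⟩, rfl⟩
      · rcases hz with rfl | hz
        · by_cases hy0 : y = 0
          · exact Or.inl ⟨m, hm, m, hm, by linarith⟩
          · exact Or.inr ⟨y, ⟨hy0, Or.inr hy⟩, add_comm _ _⟩
        · exact Or.inl ⟨y, hy, z, hz, rfl⟩
    · rintro (⟨y, hy, z, hz, rfl⟩ | ⟨z, ⟨-, hz⟩, rfl⟩)
      · exact ⟨y, Or.inr hy, z, Or.inr hz, rfl⟩
      · exact ⟨2 * m, Or.inl rfl, z, hz, rfl⟩
  rw [key, Finset.card_union_of_disjoint, Finset.card_image_of_injective _ (add_right_injective _),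
    Finset.card_erase_of_mem (Finset.mem_insert_of_mem h0), Finset.card_insert_of_notMem hnot,
    Nat.add_sub_cancel]
  rw [Finset.disjoint_left]
  intro x hx hx'
  obtain ⟨y, hy, z, hz, rfl⟩ := Finset.mem_add.1 hx
  obtain ⟨w, hw, hwe⟩ := Finset.mem_image.1 hx'
  obtain ⟨hw0, hw⟩ := Finset.mem_erase.1 hw
  have h1 := (hA y hy).2
  have h2 := (hA z hz).2
  rcases Finset.mem_insert.1 hw with rfl | hw
  · linarith
  · have h3 := (hA w hw).1
    omega

/-- The sumset of an interval `[0, L]` together with a single point slightly beyond it. -/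
theorem card_add_insert_Icc {L b : ℤ} (hb0 : 0 ≤ b) (hb : b ≤ L - 1) :
    ((insert (L + 1 + b) (Finset.Icc 0 L) + insert (L + 1 + b) (Finset.Icc 0 L)).card : ℤ) =
      2 * L + 3 + b := by
  have key : insert (L + 1 + b) (Finset.Icc 0 L) + insert (L + 1 + b) (Finset.Icc 0 L) =
      insert (2 * (L + 1 + b)) (Finset.Icc 0 (2 * L + 1 + b)) := by
    ext x
    simp only [Finset.mem_add, Finset.mem_insert, Finset.mem_Icc]
    constructor
    · rintro ⟨y, hy, z, hz, rfl⟩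
      omega
    · rintro (rfl | ⟨h1, h2⟩)
      · exact ⟨L + 1 + b, Or.inl rfl, L + 1 + b, Or.inl rfl, by ring⟩
      · rcases le_or_gt x L with h | h
        · exact ⟨0, by omega, x, by omega, by ring⟩
        · rcases le_or_gt x (2 * L) with h' | h'
          · exact ⟨L, by omega, x - L, by omega, by ring⟩
          · exact ⟨L + 1 + b, by omega, x - (L + 1 + b), by omega, by ring⟩
  rw [key, Finset.card_insert_of_notMem (by simp only [Finset.mem_Icc]; omega), Int.card_Icc]
  omega

/-- The extremal set, built from an interval and a point by repeatedly adjoining twice the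
maximum. -/
theorem exists_doubling_construction {L b : ℤ} (hb0 : 0 ≤ b) (hb : b ≤ L - 1) (n : ℕ) :
    ∃ A : Finset ℤ, (A.card : ℤ) = L + 2 + n ∧ 0 ∈ A ∧ 1 ∈ A ∧ 2 ^ n * (L + 1 + b) ∈ A ∧
      (∀ x ∈ A, 0 ≤ x ∧ x ≤ 2 ^ n * (L + 1 + b)) ∧
      2 * ((A + A).card : ℤ) = 2 * (2 * L + 3 + b) + n * (2 * (L + 2) + n - 1) := by
  induction n with
  | zero =>
    refine ⟨insert (L + 1 + b) (Finset.Icc 0 L), ?_, ?_, ?_, ?_, ?_, ?_⟩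
    · rw [Finset.card_insert_of_notMem (by simp only [Finset.mem_Icc]; omega), Int.card_Icc]
      omega
    · simp only [Finset.mem_insert, Finset.mem_Icc]; omega
    · simp only [Finset.mem_insert, Finset.mem_Icc]; omega
    · simp
    · simp only [Finset.mem_insert, Finset.mem_Icc]
      intro x hx
      omega
    · rw [card_add_insert_Icc hb0 hb]
      simp
  | succ n ih =>
    obtain ⟨A, hcard, h0, h1, hm, hA, hsum⟩ := ih
    have hm0 : 0 < 2 ^ n * (L + 1 + b) := mul_pos (by positivity) (by omega)
    have hpow : (2 : ℤ) ^ (n + 1) * (L + 1 + b) = 2 * (2 ^ n * (L + 1 + b)) := by ring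
    rw [hpow]
    refine ⟨insert (2 * (2 ^ n * (L + 1 + b))) A, ?_, Finset.mem_insert_of_mem h0,
      Finset.mem_insert_of_mem h1, Finset.mem_insert_self _ _, ?_, ?_⟩
    · rw [Finset.card_insert_of_notMem fun h => by linarith [(hA _ h).2]]
      push_cast
      linarith
    · intro x hx
      rcases Finset.mem_insert.1 hx with rfl | hx
      · constructor <;> linarith
      · constructor <;> linarith [hA x hx]
    · rw [card_add_insert_two_mul_max hm0 h0 hm hA]
      push_cast
      rw [mul_add, hsum, hcard]
      ring

/-- **The general construction (Section 3.4).** For integers `2 ≤ c ≤ k - 1` and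
`0 ≤ b ≤ k - c - 1` there is a set `A ⊆ ℤ` with `|A| = k`, `min A = 0`,
`max A = 2^(c-2)·(k + 1 - c + b)`, `gcd A = 1`, and `|A + A| = ck - (c² + c - 4)/2 + b`. -/
theorem extremal_construction (k c b : ℤ) (hc : 2 ≤ c) (hck : c ≤ k - 1)
    (hb0 : 0 ≤ b) (hb : b ≤ k - c - 1) :
    ∃ (A : Finset ℤ) (hne : A.Nonempty),
      (A.card : ℤ) = k ∧
      A.min' hne = 0 ∧
      A.max' hne = 2 ^ (c - 2).toNat * (k + 1 - c + b) ∧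
      A.gcd id = 1 ∧
      ((A + A).card : ℤ) = c * k - (c ^ 2 + c - 4) / 2 + b := by
  obtain ⟨A, hcard, h0, h1, hm, hA, hsum⟩ :=
    exists_doubling_construction (L := k - c) hb0 hb (c - 2).toNat
  have hn : ((c - 2).toNat : ℤ) = c - 2 := Int.toNat_of_nonneg (by omega)
  rw [hn] at hcard hsum
  rw [show k - c + 1 + b = k + 1 - c + b by ring] at hm hA
  refine ⟨A, ⟨0, h0⟩, by linarith, ?_, ?_, ?_, ?_⟩
  · exact le_antisymm (Finset.min'_le _ _ h0) (Finset.le_min' _ _ _ fun x hx => (hA x hx).1)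
  · exact le_antisymm (Finset.max'_le _ _ _ fun x hx => (hA x hx).2) (Finset.le_max' _ _ hm)
  · have hdvd : A.gcd id ∣ 1 := Finset.gcd_dvd h1
    rw [← Finset.normalize_gcd]
    exact normalize_eq_one.2 (isUnit_of_dvd_one hdvd)
  · have h2 : c ^ 2 + c - 4 = 2 * (c * k + b - ((A + A).card : ℤ)) := by linear_combination hsum
    rw [h2, Int.mul_ediv_cancel_left _ two_ne_zero]
    ring
end

section
/- Let A be a finite set of integers with |A| = k ≥ 3 and |A + A| = 2k − 1 + b where 0 ≤ b ≤ k − 3. Then A is contained in an arithmetic progression of integers with k + b terms. -/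
open Pointwise

/-- A nonempty set `F` minimising `|X + S| - |X|` over the nonempty `X` with `X + S ≠ G`, and of
least size among the minimisers, can be taken to be a subgroup of `G`. -/
theorem exists_addSubgroup_isoperimetric {G : Type*} [AddCommGroup G] [Fintype G] [DecidableEq G]
    (S : Finset G) (X₀ : Finset G) (hX₀ : X₀.Nonempty) (hX₀S : X₀ + S ≠ Finset.univ) :
    ∃ (H : AddSubgroup G) (F : Finset G), (∀ x, x ∈ F ↔ x ∈ H) ∧ F + S ≠ Finset.univ ∧
      ∀ X : Finset G, X.Nonempty → X + S ≠ Finset.univ →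
        X.card + (F + S).card ≤ (X + S).card + F.card := by
  classical
  let κ : Finset G → ℤ := fun X => ((X + S).card : ℤ) - X.card
  let P : Finset (Finset G) := Finset.univ.filter fun X => X.Nonempty ∧ X + S ≠ Finset.univ
  have memP : ∀ X, X ∈ P ↔ X.Nonempty ∧ X + S ≠ Finset.univ := fun X => by simp [P]
  obtain ⟨F₁, hF₁P, hF₁⟩ := Finset.exists_min_image P κ ⟨X₀, (memP _).2 ⟨hX₀, hX₀S⟩⟩
  obtain ⟨F₂, hF₂P, hF₂⟩ := Finset.exists_min_image (P.filter fun X => κ X = κ F₁) Finset.card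
    ⟨F₁, by simp [hF₁P]⟩
  rw [Finset.mem_filter, memP] at hF₂P
  obtain ⟨⟨⟨x, hx⟩, hF₂S⟩, hκ₂⟩ := hF₂P
  obtain ⟨F, hF⟩ : ∃ F, F = (-x) +ᵥ F₂ := ⟨_, rfl⟩
  have hFcard : F.card = F₂.card := by rw [hF, Finset.card_vadd_finset]
  have hFScard : (F + S).card = (F₂ + S).card := by
    rw [hF, vadd_add_assoc, Finset.card_vadd_finset]
  have h0 : (0 : G) ∈ F := by
    rw [hF, Finset.mem_vadd_finset]
    exact ⟨x, hx, by simp⟩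
  have hFS : F + S ≠ Finset.univ := by
    rw [Ne, ← Finset.card_eq_iff_eq_univ, hFScard, Finset.card_eq_iff_eq_univ]
    exact hF₂S
  have hmin : ∀ X : Finset G, X.Nonempty → X + S ≠ Finset.univ →
      X.card + (F + S).card ≤ (X + S).card + F.card := by
    intro X hX hXS
    have := hF₁ X ((memP X).2 ⟨hX, hXS⟩)
    simp only [κ] at this hκ₂
    omega
  have hatom : ∀ X : Finset G, X.Nonempty → X + S ≠ Finset.univ →
      (X + S).card + F.card ≤ X.card + (F + S).card → F.card ≤ X.card := by
    intro X hX hXS hle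
    have h1 := hmin X hX hXS
    rw [hFcard]
    refine hF₂ X (Finset.mem_filter.2 ⟨(memP X).2 ⟨hX, hXS⟩, ?_⟩)
    simp only [κ] at hκ₂ ⊢
    omega
  have ne_univ : ∀ X : Finset G, X.card < Fintype.card G → X ≠ Finset.univ := by
    rintro X hX rfl
    simp at hX
  have hdual : (F + S).card + F.card ≤ Fintype.card G := by
    have hne : (-(F + S)ᶜ).Nonempty := by
      rw [Finset.neg_nonempty_iff, Finset.nonempty_iff_ne_empty, Ne, Finset.compl_eq_empty_iff]
      exact hFS
    have hsub : -(F + S)ᶜ + S ⊆ (-F)ᶜ := by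
      intro z hz
      obtain ⟨y, hy, s, hs, rfl⟩ := Finset.mem_add.1 hz
      rw [Finset.mem_neg', Finset.mem_compl] at hy
      rw [Finset.mem_compl, Finset.mem_neg']
      intro h
      exact hy (Finset.mem_add.2 ⟨_, h, s, hs, by abel⟩)
    have hc1 := Finset.card_le_card hsub
    have hc2 : (-(F + S)ᶜ).card + (F + S).card = Fintype.card G := by
      rw [Finset.card_neg, Finset.card_compl_add_card]
    have hc3 : ((-F)ᶜ).card + F.card = Fintype.card G := by
      rw [← Finset.card_neg F, Finset.card_compl_add_card]
    have hpos : 0 < F.card := Finset.card_pos.2 ⟨0, h0⟩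
    have := hatom _ hne (ne_univ _ (by omega)) (by omega)
    omega
  have hstab : ∀ g ∈ F, g +ᵥ F = F := by
    intro g hg
    have hgF : g ∈ g +ᵥ F := Finset.mem_vadd_finset.2 ⟨0, h0, by simp⟩
    have hI : (F ∩ (g +ᵥ F)).Nonempty := ⟨g, Finset.mem_inter.2 ⟨hg, hgF⟩⟩
    have hIpos := Finset.card_pos.2 hI
    have hsubI : (F ∩ (g +ᵥ F)) + S ⊆ (F + S) ∩ ((g +ᵥ F) + S) := Finset.inter_add_subset
    have hcI := Finset.card_le_card hsubI
    have hcI' := Finset.card_le_card (hsubI.trans Finset.inter_subset_left)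
    have hie := Finset.card_union_add_card_inter (F + S) ((g +ᵥ F) + S)
    rw [← Finset.union_add, vadd_add_assoc, Finset.card_vadd_finset,
      ← vadd_add_assoc] at hie
    have hie' := Finset.card_union_add_card_inter F (g +ᵥ F)
    rw [Finset.card_vadd_finset] at hie'
    have hFpos : 0 < F.card := Finset.card_pos.2 ⟨0, h0⟩
    have hIS : (F ∩ (g +ᵥ F)) + S ≠ Finset.univ := ne_univ _ (by omega)
    have h1 := hmin _ hI hIS
    have h2 := hmin (F ∪ (g +ᵥ F)) ⟨0, Finset.mem_union_left _ h0⟩ (ne_univ _ (by omega))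
    have h3 := hatom _ hI hIS (by omega)
    have h4 : F ∩ (g +ᵥ F) = F := Finset.eq_of_subset_of_card_le Finset.inter_subset_left h3
    exact (Finset.eq_of_subset_of_card_le (Finset.inter_eq_left.1 h4)
      (by rw [Finset.card_vadd_finset])).symm
  refine ⟨{ carrier := F, add_mem' := ?_, zero_mem' := h0, neg_mem' := ?_ }, F,
    fun x => Iff.rfl, hFS, hmin⟩
  · intro a b ha hb
    have : a + b ∈ a +ᵥ F := Finset.mem_vadd_finset.2 ⟨b, hb, rfl⟩
    rwa [hstab a ha] at this
  · intro a ha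
    have h := h0
    rw [← hstab a ha] at h
    obtain ⟨b, hb, hab⟩ := Finset.mem_vadd_finset.1 h
    have : -a = b := neg_eq_of_add_eq_zero_right hab
    rw [this]
    exact hb

/-- A coset of a subgroup has as many elements as the subgroup. -/
theorem card_filter_mk'_eq {G : Type*} [AddCommGroup G] [Fintype G] [DecidableEq G]
    (H : AddSubgroup G) [DecidableEq (G ⧸ H)] (F : Finset G) (hF : ∀ x, x ∈ F ↔ x ∈ H)
    (c : G ⧸ H) :
    (Finset.univ.filter fun z => QuotientAddGroup.mk' H z = c).card = F.card := by
  obtain ⟨x, rfl⟩ := QuotientAddGroup.mk'_surjective H c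
  rw [← Finset.card_vadd_finset x F]
  congr 1
  ext z
  rw [Finset.mem_filter, Finset.mem_vadd_finset]
  constructor
  · rintro ⟨-, h⟩
    exact ⟨-x + z, (hF _).2 (QuotientAddGroup.eq.1 h.symm), by simp⟩
  · rintro ⟨f, hf, rfl⟩
    exact ⟨Finset.mem_univ _, (QuotientAddGroup.eq.2 (by simpa using (hF f).1 hf)).symm⟩

/-- Adding a subgroup to `X` gives the union of the cosets meeting `X`. -/
theorem card_add_subgroup_eq {G : Type*} [AddCommGroup G] [Fintype G] [DecidableEq G]
    (H : AddSubgroup G) [DecidableEq (G ⧸ H)] (F : Finset G) (hF : ∀ x, x ∈ F ↔ x ∈ H)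
    (X : Finset G) :
    (X + F).card = (X.image (QuotientAddGroup.mk' H)).card * F.card := by
  have hmem : ∀ z, z ∈ X + F ↔ QuotientAddGroup.mk' H z ∈ X.image (QuotientAddGroup.mk' H) := by
    intro z
    rw [Finset.mem_add, Finset.mem_image]
    constructor
    · rintro ⟨x, hx, f, hf, rfl⟩
      exact ⟨x, hx, QuotientAddGroup.eq.2 (by simpa using (hF f).1 hf)⟩
    · rintro ⟨x, hx, h⟩
      exact ⟨x, hx, -x + z, (hF _).2 (QuotientAddGroup.eq.1 h), by simp⟩
  rw [Finset.card_eq_sum_card_fiberwise fun z hz => (hmem z).1 hz, Finset.sum_const_nat]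
  intro c hc
  rw [← card_filter_mk'_eq H F hF c]
  congr 1
  ext z
  simp only [Finset.mem_filter, Finset.mem_univ, true_and, hmem, and_iff_right_iff_imp]
  rintro rfl
  exact hc

/-- Pigeonhole: `z` lies in `X + Y` as soon as `X` and `z - Y` are too large to be disjoint
subsets of `C`. -/
theorem mem_add_of_card_lt {G : Type*} [AddCommGroup G] [DecidableEq G] (C X Y : Finset G) (z : G)
    (hX : X ⊆ C) (hY : ∀ y ∈ Y, z - y ∈ C) (hcard : C.card < X.card + Y.card) : z ∈ X + Y := by
  have hinj : (Y.image fun y => z - y).card = Y.card :=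
    Finset.card_image_of_injective _ sub_right_injective
  have hsub : (Y.image fun y => z - y) ⊆ C := Finset.image_subset_iff.2 hY
  rw [← hinj] at hcard
  obtain ⟨w, hw⟩ := Finset.inter_nonempty_of_card_lt_card_add_card hX hsub hcard
  obtain ⟨hwX, hwY⟩ := Finset.mem_inter.1 hw
  obtain ⟨y, hy, rfl⟩ := Finset.mem_image.1 hwY
  exact Finset.mem_add.2 ⟨_, hwX, y, hy, by simp⟩

/-- If `V ⊆ [0, n]` and both `V` and `V + n` lie in `T`, then `T` has at least `|V|` more
elements than residues modulo `n`. -/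
theorem card_image_cast_add_card_le (n : ℕ) (hn : 0 < n) (T V : Finset ℤ) (hVT : V ⊆ T)
    (hV : ∀ v ∈ V, 0 ≤ v ∧ v ≤ n) (hVn : ∀ v ∈ V, v + n ∈ T) :
    (T.image (Int.cast : ℤ → ZMod n)).card + V.card ≤ T.card := by
  have himg : T.image (Int.cast : ℤ → ZMod n) ⊆ (T \ V).image (Int.cast : ℤ → ZMod n) := by
    intro r hr
    obtain ⟨t, ht, rfl⟩ := Finset.mem_image.1 hr
    by_cases htV : t ∈ V
    · by_cases htn : t + n ∈ V
      · have h1 := hV _ htV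
        have h2 := hV _ htn
        refine Finset.mem_image.2 ⟨t + n + n, Finset.mem_sdiff.2 ⟨hVn _ htn, fun h => ?_⟩,
          by simp⟩
        have h3 := hV _ h
        omega
      · exact Finset.mem_image.2 ⟨t + n, Finset.mem_sdiff.2 ⟨hVn _ htV, htn⟩, by simp⟩
    · exact Finset.mem_image_of_mem _ (Finset.mem_sdiff.2 ⟨ht, htV⟩)
  have h1 := (Finset.card_le_card himg).trans Finset.card_image_le
  have h2 := Finset.card_sdiff_add_card_eq_card hVT
  omega

/-- Total size of the classes outside `U` in terms of the deficiencies `δ` of the classes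
in `U`. -/
theorem sum_ge_of_deficiency {Q : Type*} [AddCommGroup Q] [DecidableEq Q] (U P : Finset Q)
    (h0 : (0 : Q) ∈ U) (hPU : P ⊆ U + U) (hdisj : ∀ c ∈ P, c ∉ U) (δ t : Q → ℤ) (m : ℤ)
    (hδ : ∀ i, 0 ≤ δ i) (ht : ∀ i ∈ U, ∀ j ∈ U, i + j ∈ P → m - δ i - δ j ≤ t (i + j)) :
    P.card * (m - ∑ i ∈ U, δ i) - (∑ i ∈ U, δ i - δ 0) ≤ ∑ c ∈ P, t c := by
  have hrep : ∀ c : Q, ∃ i j, c ∈ P → i ∈ U ∧ j ∈ U ∧ i + j = c := by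
    intro c
    by_cases hc : c ∈ P
    · obtain ⟨i, hi, j, hj, h⟩ := Finset.mem_add.1 (hPU hc)
      exact ⟨i, j, fun _ => ⟨hi, hj, h⟩⟩
    · exact ⟨0, 0, fun h => absurd h hc⟩
  choose i j hij using hrep
  have hone : ∀ c ∈ P, m - ∑ i ∈ U, δ i - (if i c = j c then δ (i c) else 0) ≤ t c := by
    intro c hc
    obtain ⟨hi, hj, hs⟩ := hij c hc
    have h1 := ht _ hi _ hj (by rwa [hs])
    rw [hs] at h1
    split_ifs with h
    · have := Finset.single_le_sum (f := δ) (fun i _ => hδ i) hi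
      rw [← h] at h1
      linarith
    · have h2 : ∑ x ∈ {i c, j c}, δ x ≤ ∑ x ∈ U, δ x :=
        Finset.sum_le_sum_of_subset_of_nonneg
          (Finset.insert_subset hi (Finset.singleton_subset_iff.2 hj)) (fun x _ _ => hδ x)
      rw [Finset.sum_pair h] at h2
      linarith
  have hdiag : ∑ c ∈ P, (if i c = j c then δ (i c) else 0) ≤ ∑ x ∈ U, δ x - δ 0 := by
    rw [← Finset.sum_filter, ← Finset.sum_erase_eq_sub h0]
    have hinj : Set.InjOn i (P.filter fun c => i c = j c : Finset Q) := by
      intro c hc c' hc' h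
      simp only [Finset.coe_filter, Set.mem_ofPred_eq] at hc hc'
      rw [← (hij c hc.1).2.2, ← (hij c' hc'.1).2.2, ← hc.2, ← hc'.2, h]
    rw [← Finset.sum_image (f := δ) hinj]
    refine Finset.sum_le_sum_of_subset_of_nonneg ?_ fun x _ _ => hδ x
    intro x hx
    obtain ⟨c, hc, rfl⟩ := Finset.mem_image.1 hx
    rw [Finset.mem_filter] at hc
    obtain ⟨hi, hj, hs⟩ := hij c hc.1
    refine Finset.mem_erase.2 ⟨fun h => hdisj c hc.1 ?_, hi⟩
    rw [← hs, ← hc.2, h, add_zero]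
    exact h0
  have := Finset.sum_le_sum hone
  rw [Finset.sum_sub_distrib, Finset.sum_const, nsmul_eq_mul] at this
  linarith

/-- Freiman's theorem for sets in normal form: `0, n ∈ A ⊆ [0, n]`, with `A` generating `ℤ`. -/
theorem add_card_le_card_add_self (n : ℕ) (hn : 0 < n) (A : Finset ℤ) (h0 : 0 ∈ A)
    (hnA : (n : ℤ) ∈ A) (hA : ∀ a ∈ A, 0 ≤ a ∧ a ≤ n)
    (hgen : ∀ K : AddSubgroup ℤ, (∀ a ∈ A, a ∈ K) → K = ⊤)
    (hsmall : (A + A).card + 4 ≤ 3 * A.card) : n + A.card ≤ (A + A).card := by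
  classical
  have : NeZero n := ⟨hn.ne'⟩
  obtain ⟨S, hSdef⟩ : ∃ S, S = A.image (Int.cast : ℤ → ZMod n) := ⟨_, rfl⟩
  have hSmem : ∀ a ∈ A, (a : ZMod n) ∈ S := fun a ha => hSdef ▸ Finset.mem_image_of_mem _ ha
  have h0S : (0 : ZMod n) ∈ S := by simpa using hSmem 0 h0
  have hScard : S.card + 1 = A.card := by
    have h1 : S = (A.erase n).image (Int.cast : ℤ → ZMod n) := by
      rw [hSdef]
      refine Finset.Subset.antisymm (fun r hr => ?_)
        (Finset.image_subset_image (Finset.erase_subset _ _))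
      obtain ⟨a, ha, rfl⟩ := Finset.mem_image.1 hr
      by_cases han : a = n
      · exact Finset.mem_image.2 ⟨0, Finset.mem_erase.2 ⟨by omega, h0⟩, by simp [han]⟩
      · exact Finset.mem_image_of_mem _ (Finset.mem_erase.2 ⟨han, ha⟩)
    rw [h1, Finset.card_image_of_injOn, Finset.card_erase_add_one hnA]
    intro a ha b hb hab
    rw [Finset.mem_coe, Finset.mem_erase] at ha hb
    have h2 := hA a ha.2
    have h3 := hA b hb.2
    have h4 := (ZMod.intCast_eq_intCast_iff' a b n).1 hab
    rwa [Int.emod_eq_of_lt h2.1 (by omega), Int.emod_eq_of_lt h3.1 (by omega)] at h4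
  have hAA : (A + A).image (Int.cast : ℤ → ZMod n) = S + S := by
    rw [hSdef]
    exact Finset.image_add (Int.castAddHom (ZMod n))
  have hbase : (S + S).card + A.card ≤ (A + A).card := by
    rw [← hAA]
    exact card_image_cast_add_card_le n hn _ A
      (fun a ha => Finset.mem_add.2 ⟨a, ha, 0, h0, add_zero a⟩) hA
      fun a ha => Finset.add_mem_add ha hnA
  by_cases hSS : S + S = Finset.univ
  · rwa [hSS, Finset.card_univ, ZMod.card] at hbase
  exfalso
  have h2S : 2 * S.card ≤ n := by
    by_contra! hlt
    refine hSS (Finset.eq_univ_iff_forall.2 fun z => mem_add_of_card_lt Finset.univ S S z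
      (Finset.subset_univ _) (fun _ _ => Finset.mem_univ _) ?_)
    rw [Finset.card_univ, ZMod.card]
    omega
  obtain ⟨H, F, hF, hFS, hiso⟩ := exists_addSubgroup_isoperimetric S S ⟨0, h0S⟩ hSS
  let q := QuotientAddGroup.mk' H
  have hfib : ∀ c, (Finset.univ.filter fun z => q z = c).card = F.card :=
    card_filter_mk'_eq H F hF
  have hcosets : ∀ X : Finset (ZMod n), (X + F).card = (X.image q).card * F.card :=
    card_add_subgroup_eq H F hF
  obtain ⟨U, hU⟩ : ∃ U, U = S.image q := ⟨_, rfl⟩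
  have hUmem : ∀ s ∈ S, q s ∈ U := fun s hs => hU ▸ Finset.mem_image_of_mem _ hs
  have h0U : (0 : ZMod n ⧸ H) ∈ U := by simpa using hUmem 0 h0S
  have hUU : (S + S).image q = U + U := by
    rw [hU]
    exact Finset.image_add q
  have hu : 2 ≤ U.card := by
    by_contra! hlt
    have hU0 : ∀ c ∈ U, c = 0 := fun c hc =>
      Finset.card_le_one.1 (by omega) c hc 0 h0U
    have hK := hgen (H.comap (Int.castAddHom (ZMod n))) fun a ha =>
      (QuotientAddGroup.eq_zero_iff (a : ZMod n)).1 (hU0 _ (hUmem _ (hSmem a ha)))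
    refine hFS (Finset.eq_univ_iff_forall.2 fun z => ?_)
    refine Finset.mem_add.2 ⟨z, (hF z).2 ?_, 0, h0S, add_zero z⟩
    obtain ⟨m, rfl⟩ := ZMod.intCast_surjective z
    have : m ∈ H.comap (Int.castAddHom (ZMod n)) := hK ▸ AddSubgroup.mem_top m
    exact this
  have hFScard : (F + S).card = U.card * F.card := by rw [add_comm, hcosets, hU]
  have hh : 0 < F.card := Finset.card_pos.2 ⟨0, (hF 0).2 H.zero_mem⟩
  have hSF : S.card ≤ U.card * F.card := by
    rw [← hFScard]
    exact Finset.card_le_card fun s hs =>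
      Finset.mem_add.2 ⟨0, (hF 0).2 H.zero_mem, s, hs, zero_add s⟩
  -- the total deficiency of `S` in the cosets it meets is small
  have hD : U.card * F.card + 2 ≤ S.card + F.card := by
    have := hiso S ⟨0, h0S⟩ hSS
    omega
  have hw : 2 * U.card ≤ (U + U).card + 1 := by
    have hw' : (S + F + S).card = (U + U).card * F.card := by
      rw [add_right_comm, hcosets, hUU]
    refine Nat.le_of_mul_le_mul_right ?_ hh
    by_cases hne : S + F + S = Finset.univ
    · rw [hne, Finset.card_univ, ZMod.card] at hw'
      have : 2 * U.card * F.card < ((U + U).card + 2) * F.card := by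
        rw [add_mul, ← hw']
        linarith
      have h3 : 2 * U.card < (U + U).card + 2 := lt_of_mul_lt_mul_right this (Nat.zero_le _)
      exact Nat.mul_le_mul_right _ (by omega)
    · have h3 := hiso (S + F) ⟨0, Finset.mem_add.2 ⟨0, h0S, 0, (hF 0).2 H.zero_mem, add_zero 0⟩⟩ hne
      rw [hw', hFScard, hcosets, ← hU] at h3
      linarith
  have hUsub : U ⊆ U + U := fun c hc => Finset.mem_add.2 ⟨c, hc, 0, h0U, add_zero c⟩
  obtain ⟨P, hPsub, hPcard⟩ : ∃ P ⊆ (U + U) \ U, P.card = U.card - 1 := by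
    refine Finset.exists_subset_card_eq ?_
    rw [Finset.card_sdiff_of_subset hUsub]
    omega
  have hPUU : P ⊆ U + U := hPsub.trans Finset.sdiff_subset
  have hPU : ∀ c ∈ P, c ∉ U := fun c hc => (Finset.mem_sdiff.1 (hPsub hc)).2
  -- class sizes
  let p : ℤ → ZMod n ⧸ H := fun x => q x
  have hp : ∀ x y, p (x + y) = p x + p y := fun x y => by simp [p]
  have himg : ∀ (B : Finset ℤ) (c : ZMod n ⧸ H),
      (B.filter fun x => p x = c).image (Int.cast : ℤ → ZMod n) =
        (B.image (Int.cast : ℤ → ZMod n)).filter fun z => q z = c := by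
    intro B c
    rw [Finset.filter_image]
  let α : ZMod n ⧸ H → ℕ := fun c => (S.filter fun z => q z = c).card
  let β : ZMod n ⧸ H → ℕ := fun c => ((S + S).filter fun z => q z = c).card
  let γ : ZMod n ⧸ H → ℕ := fun c => (A.filter fun x => p x = c).card
  let t : ZMod n ⧸ H → ℕ := fun c => ((A + A).filter fun x => p x = c).card
  have hα : ∀ c, α c ≤ F.card := fun c => by
    rw [← hfib c]
    exact Finset.card_le_card (Finset.filter_subset_filter _ (Finset.subset_univ _))
  have hαγ : ∀ c, α c ≤ γ c := fun c => by
    simp only [α, γ]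
    rw [hSdef, ← himg]
    exact Finset.card_image_le
  have hαβ : α 0 ≤ β 0 := Finset.card_le_card (Finset.filter_subset_filter _
    fun s hs => Finset.mem_add.2 ⟨s, hs, 0, h0S, add_zero s⟩)
  have hβγ : ∀ c, β c + γ c ≤ t c := fun c => by
    simp only [β, γ, t]
    rw [← hAA, ← himg]
    refine card_image_cast_add_card_le n hn _ _ ?_ ?_ ?_
    · exact Finset.filter_subset_filter _ fun a ha => Finset.mem_add.2 ⟨a, ha, 0, h0, add_zero a⟩
    · exact fun v hv => hA v (Finset.mem_filter.1 hv).1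
    · intro v hv
      rw [Finset.mem_filter] at hv ⊢
      refine ⟨Finset.add_mem_add hv.1 hnA, ?_⟩
      rw [hp, hv.2]
      simp [p]
  have hsumα : ∑ c ∈ U, α c = S.card :=
    (Finset.card_eq_sum_card_fiberwise fun s hs => hUmem s hs).symm
  have hsumγ : ∑ c ∈ U, γ c = A.card :=
    (Finset.card_eq_sum_card_fiberwise fun a ha => hUmem _ (hSmem a ha)).symm
  let δ : ZMod n ⧸ H → ℤ := fun c => F.card - α c
  have hδ : ∀ c, 0 ≤ δ c := fun c => by
    have := hα c
    simp only [δ]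
    omega
  have hsumδ : ∑ c ∈ U, δ c = U.card * F.card - S.card := by
    simp only [δ]
    rw [Finset.sum_sub_distrib, Finset.sum_const, nsmul_eq_mul, ← hsumα]
    push_cast
    rfl
  have hβ : ∀ c ∈ U.erase 0, F.card ≤ β c := by
    intro c hc
    rw [Finset.mem_erase] at hc
    have hle : ∑ x ∈ {0, c}, δ x ≤ ∑ x ∈ U, δ x :=
      Finset.sum_le_sum_of_subset_of_nonneg
        (Finset.insert_subset h0U (Finset.singleton_subset_iff.2 hc.2)) fun x _ _ => hδ x
    rw [Finset.sum_pair hc.1.symm, hsumδ] at hle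
    rw [← hfib c]
    refine Finset.card_le_card fun z hz => ?_
    rw [Finset.mem_filter] at hz ⊢
    refine ⟨?_, hz.2⟩
    refine Finset.add_subset_add (Finset.filter_subset (fun z => q z = 0) S)
      (Finset.filter_subset (fun z => q z = c) S)
      (mem_add_of_card_lt (Finset.univ.filter fun z => q z = 0) _ _ z
        (Finset.filter_subset_filter _ (Finset.subset_univ _)) ?_ ?_)
    · intro y hy
      rw [Finset.mem_filter] at hy ⊢
      exact ⟨Finset.mem_univ _, by rw [map_sub, hz.2, hy.2, sub_self]⟩
    · rw [hfib]
      change F.card < α 0 + α c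
      simp only [δ] at hle
      zify at hD ⊢
      linarith
  have hsumβ : α 0 + (U.card - 1) * F.card ≤ ∑ c ∈ U, β c := by
    rw [← Finset.add_sum_erase U β h0U, ← Finset.card_erase_of_mem h0U, ← smul_eq_mul]
    exact Nat.add_le_add hαβ (Finset.card_nsmul_le_sum _ _ _ hβ)
  have htU : ∑ c ∈ U, β c + A.card ≤ ∑ c ∈ U, t c := by
    rw [← hsumγ, ← Finset.sum_add_distrib]
    exact Finset.sum_le_sum fun c _ => hβγ c
  have htP := sum_ge_of_deficiency U P h0U hPUU hPU δ (fun c => (t c : ℤ)) (2 * F.card - 1) hδ (by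
    intro i hi j hj _
    have hne : ∀ c ∈ U, (A.filter fun x => p x = c).Nonempty := by
      intro c hc
      rw [hU, hSdef] at hc
      simp only [Finset.mem_image, exists_exists_and_eq_and] at hc
      obtain ⟨a, ha, hac⟩ := hc
      exact ⟨a, Finset.mem_filter.2 ⟨ha, hac⟩⟩
    have hcd := cauchy_davenport_add_of_linearOrder_isCancelAdd (hne i hi) (hne j hj)
    have hsub : (A.filter fun x => p x = i) + (A.filter fun x => p x = j) ⊆
        (A + A).filter fun x => p x = i + j := by
      intro x hx
      obtain ⟨a, ha, b, hb, rfl⟩ := Finset.mem_add.1 hx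
      rw [Finset.mem_filter] at ha hb ⊢
      exact ⟨Finset.add_mem_add ha.1 hb.1, by rw [hp, ha.2, hb.2]⟩
    have hle : γ i + γ j - 1 ≤ t (i + j) := hcd.trans (Finset.card_le_card hsub)
    have h1 := hαγ i
    have h2 := hαγ j
    simp only [δ]
    omega)
  have htotal : ∑ c ∈ U, t c + ∑ c ∈ P, t c ≤ (A + A).card := by
    have hmaps : ∀ x ∈ A + A, p x ∈ U + U := by
      intro x hx
      obtain ⟨a, ha, b, hb, rfl⟩ := Finset.mem_add.1 hx
      rw [hp]
      exact Finset.add_mem_add (hUmem _ (hSmem a ha)) (hUmem _ (hSmem b hb))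
    rw [Finset.card_eq_sum_card_fiberwise hmaps,
      ← Finset.sum_union (Finset.disjoint_left.2 fun c hcU hcP => hPU c hcP hcU)]
    exact Finset.sum_le_sum_of_subset (Finset.union_subset hUsub hPUU)
  rw [hsumδ, hPcard] at htP
  simp only [δ] at htP
  zify [show 1 ≤ U.card by omega] at htP htotal htU hsumβ hD hSF hScard hsmall hu
  nlinarith [mul_nonneg (sub_nonneg.2 hu)
    (sub_nonneg.2 (show (U.card : ℤ) * F.card - S.card + 2 ≤ F.card by linarith))]

/-- **Freiman's 3k−4 theorem (the "Basic Theorem").** If `A ⊆ ℤ` has `|A| = k ≥ 3` and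
`|A + A| = 2k - 1 + b` with `0 ≤ b ≤ k - 3`, then `A` is contained in an arithmetic
progression with `k + b` terms. -/
theorem freiman_3k4 (A : Finset ℤ) (k b : ℕ) (hk : 3 ≤ k) (hb : b ≤ k - 3)
    (hcard : A.card = k) (hT : (A + A).card = 2 * k - 1 + b) :
    ∃ a d : ℤ, 1 ≤ d ∧
      A ⊆ (Finset.range (k + b)).image (fun i : ℕ => a + (i : ℤ) * d) := by
  have hne : A.Nonempty := Finset.card_pos.1 (by omega)
  obtain ⟨a, ha⟩ : ∃ a, a = A.min' hne := ⟨_, rfl⟩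
  obtain ⟨M, hM⟩ : ∃ M, M = A.max' hne := ⟨_, rfl⟩
  have haA : a ∈ A := ha ▸ A.min'_mem hne
  have hMA : M ∈ A := hM ▸ A.max'_mem hne
  have hlt : a < M := by
    rw [ha, hM]
    exact A.min'_lt_max'_of_card (by omega)
  obtain ⟨e, he⟩ := Int.subgroup_cyclic (AddSubgroup.closure {x | a + x ∈ A})
  rw [← AddSubgroup.zmultiples_eq_closure, ← Int.zmultiples_natAbs] at he
  obtain ⟨d, hd⟩ : ∃ d : ℤ, d = e.natAbs := ⟨_, rfl⟩
  rw [← hd] at he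
  have hdvd : ∀ x ∈ A, ∃ y, a + d * y = x := by
    intro x hx
    have : x - a ∈ AddSubgroup.zmultiples d :=
      he ▸ AddSubgroup.subset_closure (show a + (x - a) ∈ A by simpa using hx)
    obtain ⟨y, hy⟩ := Int.mem_zmultiples_iff.1 this
    exact ⟨y, by linarith⟩
  obtain ⟨m, hm⟩ := hdvd M hMA
  have hd0 : 0 < d := by
    rcases (show 0 ≤ d by omega).eq_or_lt with h | h
    · rw [← h] at hm
      linarith
    · exact h
  have hm0 : 0 < m := by
    by_contra! h
    nlinarith
  lift m to ℕ using hm0.le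
  let f : ℤ → ℤ := fun y => a + d * y
  have hf : Function.Injective f := fun x y hxy => by
    simp only [f] at hxy
    exact mul_left_cancel₀ hd0.ne' (add_left_cancel hxy)
  let B : Finset ℤ := A.preimage f hf.injOn
  have hB : ∀ y, y ∈ B ↔ a + d * y ∈ A := fun y => Finset.mem_preimage
  have hAB : B.image f = A := by
    ext x
    rw [Finset.mem_image]
    constructor
    · rintro ⟨y, hy, rfl⟩
      exact (hB y).1 hy
    · intro hx
      obtain ⟨y, rfl⟩ := hdvd x hx
      exact ⟨y, (hB y).2 hx, rfl⟩
  have hBcard : B.card = k := by rw [← hcard, ← hAB, Finset.card_image_of_injective _ hf]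
  have hBBcard : (B + B).card = 2 * k - 1 + b := by
    rw [← hT, ← Finset.card_image_of_injective (B + B) (f := fun y => a + f y)
      fun x y hxy => hf (add_left_cancel hxy)]
    congr 1
    rw [← hAB]
    exact Finset.image_image₂_distrib (fun x y => by simp only [f]; ring)
  have hBbd : ∀ y ∈ B, 0 ≤ y ∧ y ≤ m := by
    intro y hy
    have h1 : a ≤ a + d * y := ha ▸ A.min'_le _ (ha ▸ (hB y).1 hy)
    have h2 : a + d * y ≤ a + d * m := by
      rw [hm, hM]
      exact A.le_max' _ ((hB y).1 hy)
    exact ⟨nonneg_of_mul_nonneg_right (by linarith) hd0, le_of_mul_le_mul_left (by linarith) hd0⟩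
  have hcore := add_card_le_card_add_self m (by omega) B ((hB 0).2 (by simpa using haA))
    ((hB m).2 (hm ▸ hMA)) hBbd (by
      intro K hK
      have hle : AddSubgroup.closure {x | a + x ∈ A} ≤ K.map (AddMonoidHom.mulLeft d) := by
        rw [AddSubgroup.closure_le]
        intro x hx
        obtain ⟨y, hy⟩ := hdvd _ hx
        have hxy : d * y = x := add_left_cancel hy
        exact ⟨y, hK y ((hB y).2 (hy ▸ hx)), hxy⟩
      rw [he] at hle
      obtain ⟨y, hy, hyd⟩ := hle (AddSubgroup.mem_zmultiples d)
      have hy1 : y = 1 := mul_left_cancel₀ hd0.ne' (by simpa using hyd)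
      rw [hy1] at hy
      refine (AddSubgroup.eq_top_iff' K).2 fun z => ?_
      simpa using K.zsmul_mem hy z) (by omega)
  refine ⟨a, d, by omega, fun x hx => ?_⟩
  obtain ⟨y, rfl⟩ := hdvd x hx
  have hy := hBbd y ((hB y).2 hx)
  lift y to ℕ using hy.1
  exact Finset.mem_image.2 ⟨y, Finset.mem_range.2 (by omega), by ring⟩
end

section
/- Let k ≥ 3 and b be integers with 0 ≤ b ≤ k − 3. Then there exists a finite set A ⊂ ℤ with |A| = k, min A = 0, max A = k − 1 + b, the greatest common divisor of the elements of A equal to 1, and |A + A| = 2k − 1 + b. -/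
open Pointwise

/-- Adding to an interval `[0, n]` a point `m ≤ 2 * n + 1` beyond it, the sumset is an
interval together with one further point. -/
theorem insert_Icc_add_insert_Icc {n m : ℤ} (hn : 0 ≤ n) (hm : m ≤ 2 * n + 1) (hnm : n < m) :
    insert m (Finset.Icc 0 n) + insert m (Finset.Icc 0 n) =
      insert (2 * m) (Finset.Icc 0 (m + n)) := by
  ext x
  simp only [Finset.mem_add, Finset.mem_insert, Finset.mem_Icc]
  constructor
  · rintro ⟨y, hy, z, hz, rfl⟩
    omega
  · rintro (rfl | hx)
    · exact ⟨m, by omega, m, by omega, by ring⟩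
    · by_cases h₁ : m ≤ x
      · exact ⟨m, by omega, x - m, by omega, by ring⟩
      · by_cases h₂ : x ≤ n
        · exact ⟨0, by omega, x, by omega, by ring⟩
        · exact ⟨n, by omega, x - n, by omega, by ring⟩

/-- For `k ≥ 3` and `0 ≤ b ≤ k - 3` there is a set `A ⊆ ℤ` in normal form with `|A| = k`,
`min A = 0`, `max A = k - 1 + b`, `gcd A = 1` and `|A + A| = 2k - 1 + b`. -/
theorem extremal_construction_small_doubling (k b : ℕ) (hk : 3 ≤ k) (hb : b ≤ k - 3) :
    ∃ (A : Finset ℤ) (hne : A.Nonempty),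
      A.card = k ∧
      A.min' hne = 0 ∧
      A.max' hne = (k : ℤ) - 1 + b ∧
      A.gcd id = 1 ∧
      (A + A).card = 2 * k - 1 + b := by
  refine ⟨insert ((k : ℤ) - 1 + b) (Finset.Icc 0 ((k : ℤ) - 2)), Finset.insert_nonempty _ _,
    ?_, ?_, ?_, ?_, ?_⟩
  · rw [Finset.card_insert_of_notMem (by rw [Finset.mem_Icc]; omega), Int.card_Icc]
    omega
  · refine (Finset.min'_eq_iff _ _ _).2 ⟨?_, ?_⟩
    · simp only [Finset.mem_insert, Finset.mem_Icc]
      omega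
    · intro x hx
      simp only [Finset.mem_insert, Finset.mem_Icc] at hx
      omega
  · refine (Finset.max'_eq_iff _ _ _).2 ⟨Finset.mem_insert_self _ _, ?_⟩
    intro x hx
    simp only [Finset.mem_insert, Finset.mem_Icc] at hx
    omega
  · have h_one : (1 : ℤ) ∈ insert ((k : ℤ) - 1 + b) (Finset.Icc 0 ((k : ℤ) - 2)) := by
      simp only [Finset.mem_insert, Finset.mem_Icc]
      omega
    rw [← Finset.normalize_gcd, normalize_eq_one]
    exact isUnit_of_dvd_one (Finset.gcd_dvd h_one)
  · rw [insert_Icc_add_insert_Icc (by omega) (by omega) (by omega),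
      Finset.card_insert_of_notMem (by rw [Finset.mem_Icc]; omega), Int.card_Icc]
    omega
end

section
/- Let A ⊂ ℤ be a finite set in normal form with |A| = k ≥ 3, i.e. min A = 0 and the greatest common divisor of the elements of A is 1, and suppose |A + A| = 2k − 1 + b with 0 ≤ b ≤ k − 3. Then max A ≤ k − 1 + b. -/
open Pointwise

/-- The set of the first `n + 1` terms of the sequence `a`. -/
def initialTerms (a : ℕ → ℤ) (n : ℕ) : Finset ℤ := (Finset.range (n + 1)).image a

/-- The sequence `a` is strictly increasing on `{0, …, n}`. -/
def IncreasingUpTo (a : ℕ → ℤ) (n : ℕ) : Prop := ∀ i j, i < j → j ≤ n → a i < a j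

/-- The differences of the terms `a 0, …, a n` have no common divisor except units. -/
def PrimitiveUpTo (a : ℕ → ℤ) (n : ℕ) : Prop :=
  ∀ d : ℤ, (∀ i ≤ n, d ∣ a i - a 0) → IsUnit d

lemma mem_initialTerms {a : ℕ → ℤ} {n : ℕ} {x : ℤ} :
    x ∈ initialTerms a n ↔ ∃ i ≤ n, a i = x := by
  simp [initialTerms]

lemma mem_initialTerms_of_le {a : ℕ → ℤ} {n i : ℕ} (h : i ≤ n) : a i ∈ initialTerms a n :=
  mem_initialTerms.2 ⟨i, h, rfl⟩

lemma initialTerms_mono (a : ℕ → ℤ) {n m : ℕ} (h : n ≤ m) :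
    initialTerms a n ⊆ initialTerms a m := by
  intro x hx
  obtain ⟨i, hi, rfl⟩ := mem_initialTerms.1 hx
  exact mem_initialTerms_of_le (hi.trans h)

lemma IncreasingUpTo.le {a : ℕ → ℤ} {n i j : ℕ} (ha : IncreasingUpTo a n) (hij : i ≤ j)
    (hj : j ≤ n) : a i ≤ a j := by
  rcases hij.eq_or_lt with rfl | h
  · exact le_rfl
  · exact (ha i j h hj).le

lemma IncreasingUpTo.mono {a : ℕ → ℤ} {n m : ℕ} (ha : IncreasingUpTo a n) (h : m ≤ n) :
    IncreasingUpTo a m :=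
  fun i j hij hj => ha i j hij (hj.trans h)

lemma IncreasingUpTo.card_initialTerms {a : ℕ → ℤ} {n : ℕ} (ha : IncreasingUpTo a n) :
    (initialTerms a n).card = n + 1 := by
  rw [initialTerms, Finset.card_image_of_injOn, Finset.card_range]
  intro i hi j hj hij
  simp only [Finset.coe_range, Set.mem_Iio, Nat.lt_succ_iff] at hi hj
  rcases lt_trichotomy i j with h | h | h
  · exact absurd hij (ha i j h hj).ne
  · exact h
  · exact absurd hij (ha j i h hi).ne'

lemma IncreasingUpTo.sub_const {a : ℕ → ℤ} {n : ℕ} (ha : IncreasingUpTo a n) (c : ℤ) :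
    IncreasingUpTo (fun i => a i - c) n :=
  fun i j hij hj => sub_lt_sub_right (ha i j hij hj) c

lemma IncreasingUpTo.shift {a : ℕ → ℤ} {n j : ℕ} (ha : IncreasingUpTo a n) (hj : j ≤ n) :
    IncreasingUpTo (fun i => a (i + j)) (n - j) :=
  fun p q hpq hq => ha _ _ (by omega) (by omega)

lemma IncreasingUpTo.reflect {a : ℕ → ℤ} {n : ℕ} (ha : IncreasingUpTo a n) :
    IncreasingUpTo (fun i => -a (n - i)) n :=
  fun p q hpq hq => neg_lt_neg (ha _ _ (by omega) (by omega))

lemma PrimitiveUpTo.reflect {a : ℕ → ℤ} {n : ℕ} (ha : PrimitiveUpTo a n) :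
    PrimitiveUpTo (fun i => -a (n - i)) n := by
  intro d hd
  refine ha d fun i hi => ?_
  have h₁ := hd (n - i) (by omega)
  have h₂ := hd n le_rfl
  simp only [Nat.sub_sub_self hi, Nat.sub_self, Nat.sub_zero] at h₁ h₂
  have h := dvd_sub h₂ h₁
  rwa [show -a 0 - -a n - (-a i - -a n) = a i - a 0 by ring] at h

lemma primitiveUpTo_of_consecutive {a : ℕ → ℤ} {n i : ℕ} (hi : i < n)
    (h : a (i + 1) = a i + 1) : PrimitiveUpTo a n := by
  intro d hd
  have h' := dvd_sub (hd (i + 1) hi) (hd i hi.le)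
  rw [h, show a i + 1 - a 0 - (a i - a 0) = 1 by ring] at h'
  exact isUnit_of_dvd_one h'

lemma card_add_initialTerms_sub_const (a : ℕ → ℤ) (n : ℕ) (c : ℤ) :
    (initialTerms (fun i => a i - c) n + initialTerms (fun i => a i - c) n).card =
      (initialTerms a n + initialTerms a n).card := by
  have h : initialTerms (fun i => a i - c) n = (-c) +ᵥ initialTerms a n := by
    ext x
    simp only [mem_initialTerms, Finset.mem_vadd_finset, vadd_eq_add]
    constructor
    · rintro ⟨i, hi, rfl⟩
      exact ⟨a i, ⟨i, hi, rfl⟩, by ring⟩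
    · rintro ⟨_, ⟨i, hi, rfl⟩, rfl⟩
      exact ⟨i, hi, by ring⟩
  rw [h, vadd_add_assoc, add_vadd_comm, Finset.card_vadd_finset, Finset.card_vadd_finset]

lemma card_add_initialTerms_reflect (a : ℕ → ℤ) (n : ℕ) :
    (initialTerms (fun i => -a (n - i)) n + initialTerms (fun i => -a (n - i)) n).card =
      (initialTerms a n + initialTerms a n).card := by
  have h : initialTerms (fun i => -a (n - i)) n = -initialTerms a n := by
    ext x
    simp only [mem_initialTerms, Finset.mem_neg]
    constructor
    · rintro ⟨i, hi, rfl⟩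
      exact ⟨a (n - i), ⟨n - i, by omega, rfl⟩, rfl⟩
    · rintro ⟨_, ⟨i, hi, rfl⟩, rfl⟩
      exact ⟨n - i, by omega, by simp [Nat.sub_sub_self hi]⟩
  rw [h, ← neg_add, Finset.card_neg]

/-- Freiman's bound for short sets: every residue class modulo `m = max A` meets `A + A`. -/
lemma card_add_max_le_card_add_self {A : Finset ℤ} {m : ℤ} (hm : 0 < m) (h0 : 0 ∈ A)
    (hmA : m ∈ A) (hA : ∀ x ∈ A, 0 ≤ x ∧ x ≤ m) (hlen : m + 3 ≤ 2 * A.card) :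
    A.card + m ≤ (A + A).card := by
  classical
  have hcard : (A.erase m).card + 1 = A.card := Finset.card_erase_add_one hmA
  have hX : ∀ x ∈ A.erase m, 0 ≤ x ∧ x < m := fun x hx =>
    ⟨(hA x (Finset.mem_of_mem_erase hx)).1,
      lt_of_le_of_ne (hA x (Finset.mem_of_mem_erase hx)).2 (Finset.ne_of_mem_erase hx)⟩
  have hcover : ∀ r, 0 ≤ r → r < m → r ∈ A + A ∨ r + m ∈ A + A := by
    intro r hr hrm
    have hinj : Set.InjOn (fun u => (r - u) % m) (A.erase m) := by
      intro u hu v hv huv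
      have hu' := hX u hu
      have hv' := hX v hv
      have hd : m ∣ v - u := by
        have := Int.ModEq.dvd (a := r - v) (b := r - u) huv.symm
        rwa [show r - u - (r - v) = v - u by ring] at this
      have := Int.eq_zero_of_abs_lt_dvd hd (abs_lt.2 ⟨by omega, by omega⟩)
      omega
    have hnd : ¬ Disjoint (A.erase m) ((A.erase m).image fun u => (r - u) % m) := by
      intro hdis
      have hsub : A.erase m ∪ (A.erase m).image (fun u => (r - u) % m) ⊆ Finset.Ico 0 m := by
        intro x hx
        rw [Finset.mem_Ico]
        rcases Finset.mem_union.1 hx with hx | hx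
        · exact hX x hx
        · obtain ⟨u, -, rfl⟩ := Finset.mem_image.1 hx
          exact ⟨Int.emod_nonneg _ hm.ne', Int.emod_lt_of_pos _ hm⟩
      have := Finset.card_le_card hsub
      rw [Finset.card_union_of_disjoint hdis, Finset.card_image_of_injOn hinj, Int.card_Ico] at this
      omega
    obtain ⟨v, hv, hv'⟩ := Finset.not_disjoint_iff.1 hnd
    obtain ⟨u, hu, huv⟩ := Finset.mem_image.1 hv'
    have huA := Finset.mem_of_mem_erase hu
    have hvA := Finset.mem_of_mem_erase hv
    have hub := hX u hu
    have hvb := hX v hv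
    have hmem : u + v ∈ A + A := Finset.add_mem_add huA hvA
    rcases le_or_gt u r with hur | hur
    · rw [Int.emod_eq_of_lt (by omega) (by omega)] at huv
      left
      rwa [show r = u + v by omega]
    · rw [← Int.add_emod_right, Int.emod_eq_of_lt (by omega) (by omega)] at huv
      right
      rwa [show r + m = u + v by omega]
  let f : ℤ → ℤ := fun r => if r ∈ A + A then r else r + m
  have hf : Set.InjOn f (Finset.Ico 0 m) := by
    intro r hr s hs hrs
    simp only [Finset.coe_Ico, Set.mem_Ico] at hr hs
    simp only [f] at hrs
    split_ifs at hrs <;> omega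
  have hdis : Disjoint ((Finset.Ico 0 m).image f) (A.image (· + m)) := by
    rw [Finset.disjoint_left]
    intro x hx hx'
    obtain ⟨r, hr, rfl⟩ := Finset.mem_image.1 hx
    obtain ⟨u, hu, hur⟩ := Finset.mem_image.1 hx'
    rw [Finset.mem_Ico] at hr
    have hub := hA u hu
    simp only [f] at hur
    split_ifs at hur with h
    · omega
    · apply h
      rw [show r = u + 0 by omega]
      exact Finset.add_mem_add hu h0
  have hsub : (Finset.Ico 0 m).image f ∪ A.image (· + m) ⊆ A + A := by
    intro x hx
    rcases Finset.mem_union.1 hx with hx | hx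
    · obtain ⟨r, hr, rfl⟩ := Finset.mem_image.1 hx
      rw [Finset.mem_Ico] at hr
      simp only [f]
      split_ifs with h
      · exact h
      · exact (hcover r hr.1 hr.2).resolve_left h
    · obtain ⟨u, hu, rfl⟩ := Finset.mem_image.1 hx
      exact Finset.add_mem_add hu hmA
  have := Finset.card_le_card hsub
  rw [Finset.card_union_of_disjoint hdis, Finset.card_image_of_injOn hf,
    Finset.card_image_of_injective _ (add_left_injective m), Int.card_Ico] at this
  omega

lemma IncreasingUpTo.card_add_length_le {a : ℕ → ℤ} {n : ℕ} (ha : IncreasingUpTo a n)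
    (hn : 1 ≤ n) (hlen : a n - a 0 ≤ 2 * n - 1) :
    (n : ℤ) + 1 + (a n - a 0) ≤ (initialTerms a n + initialTerms a n).card := by
  have hb := ha.sub_const (a 0)
  rw [← card_add_initialTerms_sub_const a n (a 0)]
  have hcard := hb.card_initialTerms
  have := card_add_max_le_card_add_self (A := initialTerms (fun i => a i - a 0) n)
    (m := a n - a 0) (sub_pos.2 (ha 0 n hn le_rfl))
    (mem_initialTerms.2 ⟨0, by omega, sub_self _⟩) (mem_initialTerms.2 ⟨n, le_rfl, rfl⟩)
    (by
      intro x hx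
      obtain ⟨i, hi, rfl⟩ := mem_initialTerms.1 hx
      exact ⟨sub_nonneg.2 (ha.le (Nat.zero_le i) hi), sub_le_sub_right (ha.le hi le_rfl) _⟩)
    (by rw [hcard]; push_cast; omega)
  rw [hcard] at this
  push_cast at this
  exact this

/-- If all terms but the last are dense from the left, then `A + A` contains a long interval
followed by a translate of `A`. -/
lemma IncreasingUpTo.three_mul_le_of_dense {a : ℕ → ℤ} {n : ℕ} (ha : IncreasingUpTo a n)
    (hn : 1 ≤ n) (hdense : ∀ i, 1 ≤ i → i < n → a i - a 0 ≤ 2 * i - 1)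
    (hlen : 2 * n ≤ a n - a 0) :
    3 * n ≤ (initialTerms a n + initialTerms a n).card := by
  classical
  set b : ℕ → ℤ := fun i => a i - a 0
  have hb : IncreasingUpTo b n := ha.sub_const (a 0)
  have hb0 : b 0 = 0 := sub_self _
  rw [← card_add_initialTerms_sub_const a n (a 0)]
  change 3 * n ≤ (initialTerms b n + initialTerms b n).card
  have hbn : 2 * n ≤ b n := hlen
  have hinterval : Finset.Icc (0 : ℤ) (2 * n - 2) ⊆ initialTerms b n + initialTerms b n := by
    intro x hx
    rw [Finset.mem_Icc] at hx
    obtain ⟨t, ht₁, ht₂⟩ : ∃ t : ℕ, 2 * (t : ℤ) - 1 ≤ x ∧ x ≤ 2 * t :=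
      ⟨((x + 1) / 2).toNat, by omega, by omega⟩
    have htn : t + 1 ≤ n := by omega
    have hX : ∀ y ∈ initialTerms b t, 0 ≤ y ∧ y ≤ x := by
      intro y hy
      obtain ⟨i, hi, rfl⟩ := mem_initialTerms.1 hy
      refine ⟨hb0 ▸ hb.le (Nat.zero_le i) (by omega), ?_⟩
      rcases Nat.eq_zero_or_pos i with rfl | hi0
      · omega
      · have h : b i ≤ 2 * i - 1 := hdense i hi0 (by omega)
        omega
    have hcard := (hb.mono (show t ≤ n by omega)).card_initialTerms
    have hnd : ¬ Disjoint (initialTerms b t) ((initialTerms b t).image (x - ·)) := by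
      intro hdis
      have hsub : initialTerms b t ∪ (initialTerms b t).image (x - ·) ⊆ Finset.Icc 0 x := by
        intro y hy
        rw [Finset.mem_Icc]
        rcases Finset.mem_union.1 hy with hy | hy
        · exact hX y hy
        · obtain ⟨u, hu, rfl⟩ := Finset.mem_image.1 hy
          have := hX u hu
          constructor <;> omega
      have := Finset.card_le_card hsub
      rw [Finset.card_union_of_disjoint hdis,
        Finset.card_image_of_injective _ sub_right_injective, Int.card_Icc] at this
      omega
    obtain ⟨v, hv, hv'⟩ := Finset.not_disjoint_iff.1 hnd
    obtain ⟨u, hu, huv⟩ := Finset.mem_image.1 hv'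
    rw [show x = u + v by omega]
    exact Finset.add_mem_add (initialTerms_mono b (by omega) hu)
      (initialTerms_mono b (by omega) hv)
  have hshift : (initialTerms b n).image (· + b n) ⊆ initialTerms b n + initialTerms b n := by
    intro x hx
    obtain ⟨u, hu, rfl⟩ := Finset.mem_image.1 hx
    exact Finset.add_mem_add hu (mem_initialTerms_of_le le_rfl)
  have hdis : Disjoint (Finset.Icc (0 : ℤ) (2 * n - 2))
      ((initialTerms b n).image (· + b n)) := by
    rw [Finset.disjoint_left]
    intro x hx hx'
    rw [Finset.mem_Icc] at hx
    obtain ⟨u, hu, rfl⟩ := Finset.mem_image.1 hx'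
    obtain ⟨i, hi, rfl⟩ := mem_initialTerms.1 hu
    have := hb.le (Nat.zero_le i) hi
    omega
  have := Finset.card_le_card (Finset.union_subset hinterval hshift)
  rw [Finset.card_union_of_disjoint hdis,
    Finset.card_image_of_injective _ (add_left_injective (b n)), hb.card_initialTerms,
    Int.card_Icc] at this
  omega

lemma IncreasingUpTo.three_mul_le_of_dense_right {a : ℕ → ℤ} {n : ℕ} (ha : IncreasingUpTo a n)
    (hn : 1 ≤ n) (hdense : ∀ i, 1 ≤ i → i < n → a n - a i ≤ 2 * (n - i) - 1)
    (hlen : 2 * n ≤ a n - a 0) :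
    3 * n ≤ (initialTerms a n + initialTerms a n).card := by
  rw [← card_add_initialTerms_reflect]
  refine ha.reflect.three_mul_le_of_dense hn (fun i hi hin => ?_) ?_
  · have := hdense (n - i) (by omega) (by omega)
    simp only [Nat.sub_zero]
    omega
  · simp only [Nat.sub_self, Nat.sub_zero]
    omega

/-- Splitting at two consecutive terms: the two sumsets share at most three elements. -/
lemma IncreasingUpTo.card_add_card_le_of_split {a : ℕ → ℤ} {n j : ℕ} (ha : IncreasingUpTo a n)
    (hj : j + 1 ≤ n) :
    (initialTerms a (j + 1) + initialTerms a (j + 1)).card +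
      (initialTerms (fun i => a (i + j)) (n - j) +
        initialTerms (fun i => a (i + j)) (n - j)).card ≤
      (initialTerms a n + initialTerms a n).card + 3 := by
  classical
  have hright : initialTerms (fun i => a (i + j)) (n - j) ⊆ initialTerms a n := by
    intro x hx
    obtain ⟨i, hi, rfl⟩ := mem_initialTerms.1 hx
    exact mem_initialTerms_of_le (by omega)
  have hleft := initialTerms_mono a hj
  have hinter : (initialTerms a (j + 1) + initialTerms a (j + 1)) ∩
      (initialTerms (fun i => a (i + j)) (n - j) +
        initialTerms (fun i => a (i + j)) (n - j)) ⊆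
      {a j + a j, a j + a (j + 1), a (j + 1) + a (j + 1)} := by
    intro x hx
    obtain ⟨hx₁, hx₂⟩ := Finset.mem_inter.1 hx
    obtain ⟨u, hu, v, hv, rfl⟩ := Finset.mem_add.1 hx₁
    obtain ⟨y, hy, z, hz, hsum⟩ := Finset.mem_add.1 hx₂
    obtain ⟨p, hp, rfl⟩ := mem_initialTerms.1 hu
    obtain ⟨q, hq, rfl⟩ := mem_initialTerms.1 hv
    obtain ⟨r, hr, rfl⟩ := mem_initialTerms.1 hy
    obtain ⟨s, hs, rfl⟩ := mem_initialTerms.1 hz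
    simp only [Finset.mem_insert, Finset.mem_singleton]
    by_cases h : j ≤ p ∧ j ≤ q
    · obtain h' | h' : p = j ∨ p = j + 1 := by omega
      all_goals obtain h'' | h'' : q = j ∨ q = j + 1 := by omega
      all_goals grind
    · left
      have hjj := ha j (j + 1) (by omega) hj
      have hlt : a p + a q < a j + a (j + 1) := by
        rcases lt_or_ge p j with hpj | hpj
        · have := ha p j hpj (by omega)
          have := ha.le hq hj
          omega
        · have := ha q j (by omega) (by omega)
          have := ha.le hp hj
          omega
      have hr' := ha.le (show j ≤ r + j by omega) (by omega)
      have hs' := ha.le (show j ≤ s + j by omega) (by omega)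
      rcases Nat.eq_zero_or_pos r with rfl | hr0
      · rcases Nat.eq_zero_or_pos s with rfl | hs0
        · simp only [Nat.zero_add] at hsum
          exact hsum.symm
        · have := ha.le (show j + 1 ≤ s + j by omega) (by omega)
          omega
      · have := ha.le (show j + 1 ≤ r + j by omega) (by omega)
        omega
  have h₁ := Finset.card_le_card
    (Finset.union_subset (Finset.add_subset_add hleft hleft)
      (Finset.add_subset_add hright hright))
  have h₂ := (Finset.card_le_card hinter).trans Finset.card_le_three
  have h₃ := Finset.card_union_add_card_inter (initialTerms a (j + 1) + initialTerms a (j + 1))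
    (initialTerms (fun i => a (i + j)) (n - j) + initialTerms (fun i => a (i + j)) (n - j))
  omega

lemma IncreasingUpTo.two_mul_sub_le {a : ℕ → ℤ} {n p q : ℕ} (ha : IncreasingUpTo a n)
    (hpq : p ≤ q) (hq : q ≤ n) (h : ∀ i, p ≤ i → i < q → a (i + 1) ≠ a i + 1) :
    2 * ((q : ℤ) - p) ≤ a q - a p := by
  induction q, hpq using Nat.le_induction with
  | base => simp
  | succ q hpq ih =>
    have h₁ := ih (by omega) fun i hi hiq => h i hi (by omega)
    have h₂ := h q hpq (by omega)
    have h₃ := ha q (q + 1) (by omega) hq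
    push_cast
    omega

/-- The bound for all sequences whose last index is `n`. -/
def FreimanBound (n : ℕ) : Prop :=
  ∀ a : ℕ → ℤ, IncreasingUpTo a n → PrimitiveUpTo a n → 2 * n - 1 ≤ a n - a 0 →
    3 * n ≤ (initialTerms a n + initialTerms a n).card

lemma IncreasingUpTo.three_mul_le_of_not_primitive {a : ℕ → ℤ} {n : ℕ}
    (ha : IncreasingUpTo a (n + 1)) (hprim : PrimitiveUpTo a (n + 1))
    (hnot : ¬ PrimitiveUpTo a n) :
    3 * (n + 1) ≤ (initialTerms a (n + 1) + initialTerms a (n + 1)).card := by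
  classical
  unfold PrimitiveUpTo at hnot
  push Not at hnot
  obtain ⟨d, hd, hunit⟩ := hnot
  have hlast : ¬ d ∣ a (n + 1) - a 0 := by
    intro h
    refine hunit (hprim d fun i hi => ?_)
    rcases Nat.le_succ_iff.1 hi with hi | rfl
    · exact hd i hi
    · exact h
  set B := initialTerms a n
  have hBcard : B.card = n + 1 := (ha.mono n.le_succ).card_initialTerms
  have hBne : B.Nonempty := ⟨a 0, mem_initialTerms_of_le (Nat.zero_le n)⟩
  have hBsub : B ⊆ initialTerms a (n + 1) := initialTerms_mono a n.le_succ
  have hcd := cauchy_davenport_add_of_linearOrder_isCancelAdd hBne hBne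
  have hcard := ha.card_initialTerms
  have hdis : Disjoint (B + B) ((initialTerms a (n + 1)).image (a (n + 1) + ·)) := by
    rw [Finset.disjoint_left]
    intro x hx hx'
    obtain ⟨u, hu, v, hv, rfl⟩ := Finset.mem_add.1 hx
    obtain ⟨w, hw, hsum⟩ := Finset.mem_image.1 hx'
    obtain ⟨p, hp, rfl⟩ := mem_initialTerms.1 hu
    obtain ⟨q, hq, rfl⟩ := mem_initialTerms.1 hv
    obtain ⟨r, hr, rfl⟩ := mem_initialTerms.1 hw
    rcases Nat.le_succ_iff.1 hr with hr | rfl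
    · apply hlast
      have := dvd_sub (dvd_add (hd p hp) (hd q hq)) (hd r hr)
      rwa [show a p - a 0 + (a q - a 0) - (a r - a 0) = a (n + 1) - a 0 by omega] at this
    · have := ha p (n + 1) (by omega) le_rfl
      have := ha q (n + 1) (by omega) le_rfl
      simp only [Nat.succ_eq_add_one] at hsum
      omega
  have hshift : (initialTerms a (n + 1)).image (a (n + 1) + ·) ⊆
      initialTerms a (n + 1) + initialTerms a (n + 1) := by
    intro x hx
    obtain ⟨u, hu, rfl⟩ := Finset.mem_image.1 hx
    exact Finset.add_mem_add (mem_initialTerms_of_le le_rfl) hu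
  have := Finset.card_le_card (Finset.union_subset (Finset.add_subset_add hBsub hBsub) hshift)
  rw [Finset.card_union_of_disjoint hdis,
    Finset.card_image_of_injective _ (add_right_injective (a (n + 1)))] at this
  omega

/-- Deleting the last term loses at least three sums, unless the last two terms are
consecutive integers. -/
lemma IncreasingUpTo.card_add_three_le {a : ℕ → ℤ} {n : ℕ}
    (ha : IncreasingUpTo a (n + 1)) (hprim : PrimitiveUpTo a (n + 1))
    (hgap : a (n + 1) ≠ a n + 1) :
    (initialTerms a n + initialTerms a n).card + 3 ≤
      (initialTerms a (n + 1) + initialTerms a (n + 1)).card := by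
  classical
  have hlt := ha n (n + 1) n.lt_succ_self le_rfl
  have hex : ∃ i ≤ n + 1, ¬ (a (n + 1) - a n) ∣ a (n + 1) - a i := by
    by_contra! hall
    have hunit := hprim (a (n + 1) - a n) fun i hi => by
      have := dvd_sub (hall 0 (Nat.zero_le _)) (hall i hi)
      rwa [show a (n + 1) - a 0 - (a (n + 1) - a i) = a i - a 0 by ring] at this
    rcases Int.isUnit_iff.1 hunit with h | h <;> omega
  obtain ⟨i, ⟨hi, hndvd⟩, hmax⟩ : ∃ i, (i ≤ n + 1 ∧ ¬ (a (n + 1) - a n) ∣ a (n + 1) - a i) ∧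
      ∀ p, i < p → p ≤ n + 1 → (a (n + 1) - a n) ∣ a (n + 1) - a p := by
    obtain ⟨i₀, hi₀, hd₀⟩ := hex
    refine ⟨Nat.findGreatest (fun i => ¬ (a (n + 1) - a n) ∣ a (n + 1) - a i) (n + 1),
      ⟨Nat.findGreatest_le _, Nat.findGreatest_spec
        (P := fun i => ¬ (a (n + 1) - a n) ∣ a (n + 1) - a i) hi₀ hd₀⟩, fun p hp hpn => ?_⟩
    exact not_not.1 (Nat.findGreatest_is_greatest hp hpn)
  have hin : i < n := by
    by_contra hcon
    obtain rfl | rfl : i = n ∨ i = n + 1 := by omega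
    · exact hndvd dvd_rfl
    · exact hndvd (by simp)
  have hx : a (n + 1) + a i ∉ initialTerms a n + initialTerms a n := by
    intro hmem
    obtain ⟨u, hu, v, hv, hsum⟩ := Finset.mem_add.1 hmem
    obtain ⟨p, hp, rfl⟩ := mem_initialTerms.1 hu
    obtain ⟨q, hq, rfl⟩ := mem_initialTerms.1 hv
    have hpn := ha p (n + 1) (by omega) le_rfl
    have hqn := ha q (n + 1) (by omega) le_rfl
    rcases le_or_gt p i with hpi | hpi
    · have := ha.le hpi hi
      omega
    · rcases le_or_gt q i with hqi | hqi
      · have := ha.le hqi hi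
        omega
      · apply hndvd
        have := dvd_add (hmax p hpi (by omega)) (hmax q hqi (by omega))
        rwa [show a (n + 1) - a p + (a (n + 1) - a q) = a (n + 1) - a i by omega] at this
  have hlarge : ∀ y, a n + a n < y → y ∉ initialTerms a n + initialTerms a n := by
    intro y hy hmem
    obtain ⟨u, hu, v, hv, rfl⟩ := Finset.mem_add.1 hmem
    obtain ⟨p, hp, rfl⟩ := mem_initialTerms.1 hu
    obtain ⟨q, hq, rfl⟩ := mem_initialTerms.1 hv
    have := ha.le hp n.le_succ
    have := ha.le hq n.le_succ
    omega
  have hlt' := ha i n hin n.le_succ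
  have hdis : Disjoint (initialTerms a n + initialTerms a n)
      {a (n + 1) + a i, a (n + 1) + a n, a (n + 1) + a (n + 1)} := by
    rw [Finset.disjoint_right]
    intro y hy
    simp only [Finset.mem_insert, Finset.mem_singleton] at hy
    rcases hy with rfl | rfl | rfl
    · exact hx
    · exact hlarge _ (by omega)
    · exact hlarge _ (by omega)
  have hsub : ({a (n + 1) + a i, a (n + 1) + a n, a (n + 1) + a (n + 1)} : Finset ℤ) ⊆
      initialTerms a (n + 1) + initialTerms a (n + 1) := by
    intro y hy
    simp only [Finset.mem_insert, Finset.mem_singleton] at hy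
    rcases hy with rfl | rfl | rfl <;>
    exact Finset.add_mem_add (mem_initialTerms_of_le le_rfl) (mem_initialTerms_of_le (by omega))
  have hthree : ({a (n + 1) + a i, a (n + 1) + a n, a (n + 1) + a (n + 1)} : Finset ℤ).card = 3 :=
    Finset.card_eq_three.2 ⟨_, _, _, by omega, by omega, by omega, rfl⟩
  have hmono := initialTerms_mono a n.le_succ
  have := Finset.card_le_card (Finset.union_subset (Finset.add_subset_add hmono hmono) hsub)
  rwa [Finset.card_union_of_disjoint hdis, hthree] at this

lemma FreimanBound.last_terms {n : ℕ} (hbound : FreimanBound n) {a : ℕ → ℤ}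
    (ha : IncreasingUpTo a (n + 1)) (hprim : PrimitiveUpTo a (n + 1)) :
    3 * (n + 1) ≤ (initialTerms a (n + 1) + initialTerms a (n + 1)).card ∨
      a (n + 1) = a n + 1 ∨ a n - a 0 ≤ 2 * n - 2 := by
  by_cases hgap : a (n + 1) = a n + 1
  · exact .inr (.inl hgap)
  by_cases hshort : a n - a 0 ≤ 2 * n - 2
  · exact .inr (.inr hshort)
  left
  by_cases hprim' : PrimitiveUpTo a n
  · have h₁ := hbound a (ha.mono n.le_succ) hprim' (by omega)
    have h₂ := ha.card_add_three_le hprim hgap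
    omega
  · exact ha.three_mul_le_of_not_primitive hprim hprim'

lemma FreimanBound.first_terms {n : ℕ} (hbound : FreimanBound n) {a : ℕ → ℤ}
    (ha : IncreasingUpTo a (n + 1)) (hprim : PrimitiveUpTo a (n + 1)) :
    3 * (n + 1) ≤ (initialTerms a (n + 1) + initialTerms a (n + 1)).card ∨
      a 1 = a 0 + 1 ∨ a (n + 1) - a 1 ≤ 2 * n - 2 := by
  have h := hbound.last_terms ha.reflect hprim.reflect
  rw [card_add_initialTerms_reflect] at h
  simp only [Nat.sub_self, Nat.sub_zero, Nat.add_sub_cancel_left] at h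
  rcases h with h | h | h
  · exact .inl h
  · exact .inr (.inl (by omega))
  · exact .inr (.inr (by omega))

/-- Either both parts of some splitting at consecutive terms are long, or the sequence is dense
from one side. -/
lemma IncreasingUpTo.exists_split_or_dense {a : ℕ → ℤ} {n : ℕ} (ha : IncreasingUpTo a n)
    (hn : 3 ≤ n) (hlen : 2 * n ≤ a n - a 0) :
    (∃ j, 1 ≤ j ∧ j + 2 ≤ n ∧ 2 * j + 1 ≤ a (j + 1) - a 0 ∧ 2 * ((n : ℤ) - j) - 1 ≤ a n - a j) ∨
      (∀ i, 1 ≤ i → i < n → a i - a 0 ≤ 2 * i - 1) ∨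
      ∀ i, 1 ≤ i → i < n → a n - a i ≤ 2 * (n - i) - 1 := by
  by_cases hsplit : ∃ j, 1 ≤ j ∧ j + 2 ≤ n ∧ 2 * j + 1 ≤ a (j + 1) - a 0 ∧
      2 * ((n : ℤ) - j) - 1 ≤ a n - a j
  · exact .inl hsplit
  right
  have hno : ∀ j, 1 ≤ j → j + 2 ≤ n →
      a (j + 1) - a 0 ≤ 2 * j ∨ a n - a j ≤ 2 * ((n : ℤ) - j) - 2 := by
    intro j hj hjn
    by_contra! hcon
    exact hsplit ⟨j, hj, hjn, by omega, by omega⟩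
  rcases hno 1 le_rfl hn with hlow | hhigh
  · left
    have hall : ∀ j, 1 ≤ j → j + 2 ≤ n → a (j + 1) - a 0 ≤ 2 * j := by
      intro j hj
      induction j, hj using Nat.le_induction with
      | base => exact fun _ => hlow
      | succ j hj ih =>
        intro hjn
        have h₁ := ih (by omega)
        have h₂ := hno (j + 1) (by omega) hjn
        push_cast at h₂ ⊢
        omega
    intro i hi hin
    obtain rfl | hi' := hi.eq_or_lt
    · have := ha 1 2 (by omega) (by omega)
      norm_num at hlow ⊢
      omega
    · have := hall (i - 1) (by omega) (by omega)
      rw [Nat.sub_add_cancel hi] at this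
      omega
  · right
    have hall : ∀ j, 1 ≤ j → j + 2 ≤ n → a n - a j ≤ 2 * ((n : ℤ) - j) - 2 := by
      intro j hj
      induction j, hj using Nat.le_induction with
      | base => exact fun _ => hhigh
      | succ j hj ih =>
        intro hjn
        have h₁ := ih (by omega)
        have h₂ := hno (j + 1) (by omega) hjn
        have h₃ := ha j (j + 1) (by omega) (by omega)
        have h₄ := ha (j + 1) (j + 1 + 1) (by omega) (by omega)
        push_cast at h₂ ⊢
        omega
    intro i hi hin
    by_cases hi' : i + 2 ≤ n
    · have := hall i hi hi'
      omega
    · have h₁ := hall (i - 1) (by omega) (by omega)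
      have h₂ := ha (i - 1) i (by omega) (by omega)
      omega

theorem freimanBound (n : ℕ) (hn : 1 ≤ n) : FreimanBound n := by
  induction n using Nat.strong_induction_on with
  | _ n ih =>
  intro a ha hprim hlen
  rcases hlen.eq_or_lt with heq | hlt
  · have := ha.card_add_length_le hn heq.ge
    omega
  have hlen' : 2 * n ≤ a n - a 0 := by omega
  obtain rfl | ⟨m, hm, rfl⟩ : n = 1 ∨ ∃ m, 1 ≤ m ∧ n = m + 1 := by
    rcases hn.eq_or_lt with h | h
    · exact .inl h.symm
    · exact .inr ⟨n - 1, by omega, by omega⟩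
  · exact ha.three_mul_le_of_dense le_rfl (fun i hi hi' => by omega) hlen'
  have hbound := ih m m.lt_succ_self hm
  rcases hbound.last_terms ha hprim with h | hlast
  · exact h
  rcases hbound.first_terms ha hprim with h | hfirst
  · exact h
  obtain rfl | hm2 : m = 1 ∨ 2 ≤ m := by omega
  · refine ha.three_mul_le_of_dense_right hn (fun i hi hi' => ?_) hlen'
    obtain rfl : i = 1 := by omega
    have := ha 0 1 (by omega) (by omega)
    norm_num at hlast ⊢
    omega
  rcases ha.exists_split_or_dense (by omega) hlen' with ⟨j, hj, hjn, hl, hr⟩ | h | h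
  · have hleft : ∃ i < j + 1, a (i + 1) = a i + 1 := by
      by_contra! hcon
      have h₁ := ha.two_mul_sub_le hj (by omega) fun i _ hi => hcon i (by omega)
      have h₂ := hcon 0 (by omega)
      simp only [Nat.zero_add] at h₂
      push_cast at h₁ hr
      omega
    have hright : ∃ i, j ≤ i ∧ i < m + 1 ∧ a (i + 1) = a i + 1 := by
      by_contra! hcon
      have h₁ := ha.two_mul_sub_le (show j + 1 ≤ m by omega) (by omega)
        fun i hi hi' => hcon i (by omega) (by omega)
      have h₂ := hcon m (by omega) (by omega)
      push_cast at h₁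
      omega
    obtain ⟨p, hp, hpp⟩ := hleft
    obtain ⟨q, hq, hqm, hqq⟩ := hright
    have h₁ := ih (j + 1) (by omega) (by omega) a (ha.mono (by omega))
      (primitiveUpTo_of_consecutive hp hpp) (by push_cast; omega)
    have h₂ := ih (m + 1 - j) (by omega) (by omega) (fun i => a (i + j)) (ha.shift (by omega))
      (primitiveUpTo_of_consecutive (i := q - j) (by omega)
        (by simp only [show q - j + 1 + j = q + 1 by omega, Nat.sub_add_cancel hq, hqq]))
      (by
        simp only [Nat.sub_add_cancel (show j ≤ m + 1 by omega), Nat.zero_add]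
        omega)
    have h₃ := ha.card_add_card_le_of_split (show j + 1 ≤ m + 1 by omega)
    omega
  · exact ha.three_mul_le_of_dense hn h hlen'
  · exact ha.three_mul_le_of_dense_right hn h hlen'

/-- A nonempty finite set of integers, listed in increasing order. -/
lemma exists_increasingUpTo_initialTerms_eq (A : Finset ℤ) {n : ℕ} (hcard : A.card = n + 1) :
    ∃ a : ℕ → ℤ, IncreasingUpTo a n ∧ initialTerms a n = A := by
  refine ⟨fun i => if h : i < n + 1 then A.orderEmbOfFin hcard ⟨i, h⟩ else 0, ?_, ?_⟩
  · intro i j hij hj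
    simp only [show i < n + 1 by omega, show j < n + 1 by omega, dif_pos]
    exact (A.orderEmbOfFin hcard).strictMono (by simpa using hij)
  · apply Finset.eq_of_subset_of_card_le
    · intro x hx
      obtain ⟨i, hi, rfl⟩ := mem_initialTerms.1 hx
      simp only [show i < n + 1 by omega, dif_pos]
      exact A.orderEmbOfFin_mem hcard _
    · rw [IncreasingUpTo.card_initialTerms, hcard]
      intro i j hij hj
      simp only [show i < n + 1 by omega, show j < n + 1 by omega, dif_pos]
      exact (A.orderEmbOfFin hcard).strictMono (by simpa using hij)

/-- If `A ⊆ ℤ` is in normal form (`min A = 0`, `gcd A = 1`) with `|A| = k ≥ 3` and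
`|A + A| = 2k - 1 + b`, `0 ≤ b ≤ k - 3`, then `max A ≤ k - 1 + b`. -/
theorem extremal_length_upper_bound (A : Finset ℤ) (hne : A.Nonempty) (k b : ℕ)
    (hk : 3 ≤ k) (hcard : A.card = k)
    (hmin : A.min' hne = 0) (hgcd : A.gcd id = 1)
    (hb : b ≤ k - 3) (hT : (A + A).card = 2 * k - 1 + b) :
    A.max' hne ≤ (k : ℤ) - 1 + b := by
  obtain ⟨n, rfl⟩ : ∃ n, k = n + 1 := ⟨k - 1, by omega⟩
  obtain ⟨a, ha, rfl⟩ := exists_increasingUpTo_initialTerms_eq A hcard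
  have ha0 : a 0 = 0 := by
    rw [← hmin]
    refine le_antisymm (Finset.le_min' _ _ _ fun x hx => ?_)
      (Finset.min'_le _ _ (mem_initialTerms_of_le (Nat.zero_le n)))
    obtain ⟨i, hi, rfl⟩ := mem_initialTerms.1 hx
    exact ha.le (Nat.zero_le i) hi
  have hmax : (initialTerms a n).max' hne ≤ a n := by
    refine Finset.max'_le _ _ _ fun x hx => ?_
    obtain ⟨i, hi, rfl⟩ := mem_initialTerms.1 hx
    exact ha.le hi le_rfl
  have hprim : PrimitiveUpTo a n := by
    intro d hd
    refine isUnit_of_dvd_one (hgcd ▸ Finset.dvd_gcd fun x hx => ?_)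
    obtain ⟨i, hi, rfl⟩ := mem_initialTerms.1 hx
    simpa [ha0] using hd i hi
  refine hmax.trans ?_
  rcases le_total (a n - a 0) (2 * n - 1) with hshort | hlong
  · have := ha.card_add_length_le (by omega) hshort
    push_cast
    omega
  · have := freimanBound n (by omega) a ha hprim hlong
    omega
end
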